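/- arXiv:1211.4469 — 5 statements merged into one kernel-verified Lean document; each statement's English description precedes it below -/
import Mathlib

section
/- Let S be a Polish space, P(S) the set of Borel probability measures on S, and M(S) the vector space of finite signed regular Borel measures on S. Suppose a total preorder ⪯ on P(S) satisfies the independence axiom and the Archimedean axiom. Then there exists a linear functional U : M(S) → ℝ whose restriction to P(S) is a numerical representation of ⪯, i.e., for all μ, ν ∈ P(S), μ ≻ ν if and only if U(μ) > U(ν). -/
open MeasureTheory

/-- Convex combination (lottery) of two measures: `α • μ + (1-α) • ν`. -/
noncomputable def mix {S : Type*} [MeasurableSpace S] (α : ℝ) (μ ν : Measure S) : Measure S :=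
  ENNReal.ofReal α • μ + ENNReal.ofReal (1 - α) • ν

/-- Strict preference associated with a weak preference relation `pref x y` (= "x ⪰ y"). -/
def StrictPref {X : Type*} (pref : X → X → Prop) (x y : X) : Prop :=
  pref x y ∧ ¬ pref y x

/-- A convex cone which misses the origin and is Archimedean is contained in an open half-space
through the origin. -/
theorem ConvexCone.exists_pos_linearMap {V : Type*} [AddCommGroup V] [Module ℝ V]
    (C : ConvexCone ℝ V) (h0 : (0 : V) ∉ C)
    (harch : ∀ u ∈ C, ∀ v ∈ C, ∃ n : ℝ, 0 < n ∧ n • u - v ∈ C) :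
    ∃ U : V →ₗ[ℝ] ℝ, ∀ u ∈ C, 0 < U u := by
  by_cases hne : ∃ e, e ∈ C
  swap
  · exact ⟨0, fun u hu => (hne ⟨u, hu⟩).elim⟩
  obtain ⟨e, he⟩ := hne
  -- the vectors dominated by a multiple of `e`
  let W : Submodule ℝ V :=
    { carrier := {v | ∃ n : ℝ, n • e + v ∈ C ∧ n • e - v ∈ C}
      zero_mem' := ⟨1, by simpa using he⟩
      add_mem' := by
        rintro u v ⟨n, hn, hn'⟩ ⟨m, hm, hm'⟩
        refine ⟨n + m, ?_, ?_⟩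
        · convert C.add_mem hn hm using 1; module
        · convert C.add_mem hn' hm' using 1; module
      smul_mem' := by
        rintro c v ⟨n, hn, hn'⟩
        rcases lt_trichotomy c 0 with hc | rfl | hc
        · refine ⟨-c * n, ?_, ?_⟩
          · convert C.smul_mem (neg_pos.2 hc) hn' using 1; module
          · convert C.smul_mem (neg_pos.2 hc) hn using 1; module
        · exact ⟨1, by simpa using he⟩
        · refine ⟨c * n, ?_, ?_⟩
          · convert C.smul_mem hc hn using 1; module
          · convert C.smul_mem hc hn' using 1; module }
  have hCW : ∀ u ∈ C, u ∈ W := by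
    intro u hu
    obtain ⟨n, hn, h⟩ := harch e he u hu
    refine ⟨n + 1, ?_, ?_⟩
    · convert C.add_mem (C.smul_mem (by linarith : 0 < n + 1) he) hu using 1
    · convert C.add_mem h he using 1; module
  let s : PointedCone ℝ W :=
    { carrier := {v | v = 0 ∨ (v : V) ∈ C}
      zero_mem' := Or.inl rfl
      add_mem' := by
        rintro u v (rfl | hu) (rfl | hv)
        · simp
        · simpa using Or.inr hv
        · simpa using Or.inr hu
        · exact Or.inr (C.add_mem hu hv)
      smul_mem' := by
        rintro ⟨c, hc⟩ v (rfl | hv)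
        · simp
        · rcases hc.eq_or_lt with rfl | hc'
          · left
            ext
            simp [Nonneg.mk_smul]
          · exact Or.inr (C.smul_mem hc' hv) }
  let e' : W := ⟨e, hCW e he⟩
  have he' : e' ≠ 0 := by
    intro h
    have h' : e = 0 := congrArg Subtype.val h
    exact h0 (by rwa [h'] at he)
  obtain ⟨g, hg, hgs⟩ := riesz_extension s
    (LinearPMap.mkSpanSingleton (σ := RingHom.id ℝ) e' (1 : ℝ) he') (by
      rintro ⟨x, hx⟩ hxs
      obtain ⟨c, rfl⟩ := Submodule.mem_span_singleton.1 hx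
      have hval : LinearPMap.mkSpanSingleton (σ := RingHom.id ℝ) e' (1 : ℝ) he' ⟨c • e', hx⟩ = c := by
        rw [LinearPMap.mkSpanSingleton'_apply]; simp
      rw [hval]
      rcases hxs with h | h
      · exact ((smul_eq_zero.1 h).resolve_right he').ge
      · by_contra! hc
        refine h0 ?_
        convert C.add_mem h (C.smul_mem (neg_pos.2 hc) he) using 1
        simp [e'])
    (by
      rintro ⟨y, n, hn, hn'⟩
      exact ⟨⟨n • e', Submodule.smul_mem _ _ (Submodule.mem_span_singleton_self _)⟩, Or.inr hn⟩)
  have hge : g e' = 1 := by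
    rw [hg ⟨e', Submodule.mem_span_singleton_self _⟩]
    exact LinearPMap.mkSpanSingleton'_apply_self _ _ _ _
  obtain ⟨U, hU⟩ := g.exists_extend
  refine ⟨U, fun u hu => ?_⟩
  have hUg : U u = g ⟨u, hCW u hu⟩ := by rw [← hU]; rfl
  rw [hUg]
  obtain ⟨n, hn, h⟩ := harch u hu e he
  have := hgs (n • ⟨u, hCW u hu⟩ - e') (Or.inr h)
  rw [map_sub, map_smul, hge, smul_eq_mul] at this
  by_contra! hneg
  nlinarith

/-- A strict preference relation on a convex set of lotteries which satisfies the axioms of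
von Neumann and Morgenstern. -/
structure IsVNMPreference {V : Type*} [AddCommGroup V] [Module ℝ V] (K : Set V)
    (R : V → V → Prop) : Prop where
  convex : Convex ℝ K
  mem : ∀ {x y}, R x y → x ∈ K ∧ y ∈ K
  asymm : ∀ {x y}, R x y → ¬ R y x
  or_of_mem : ∀ {x y z}, R x y → z ∈ K → R x z ∨ R z y
  mix : ∀ {x y z}, R x y → z ∈ K → ∀ {a b : ℝ}, 0 < a → 0 < b → a + b = 1 →
    R (a • x + b • z) (a • y + b • z)
  exists_mix_left : ∀ {x y z}, R x y → R y z →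
    ∃ a b : ℝ, 0 < a ∧ 0 < b ∧ a + b = 1 ∧ R (a • x + b • z) y
  exists_mix_right : ∀ {x y z}, R x y → R y z →
    ∃ a b : ℝ, 0 < a ∧ 0 < b ∧ a + b = 1 ∧ R y (a • x + b • z)

namespace IsVNMPreference

variable {V : Type*} [AddCommGroup V] [Module ℝ V] {K : Set V} {R : V → V → Prop}

theorem swap (h : IsVNMPreference K R) : IsVNMPreference K (Function.swap R) where
  convex := h.convex
  mem hxy := (h.mem hxy).symm
  asymm hxy := h.asymm hxy
  or_of_mem hxy hz := (h.or_of_mem hxy hz).symm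
  mix hxy hz _ _ ha hb hab := h.mix hxy hz ha hb hab
  exists_mix_left hxy hyz := by
    obtain ⟨a, b, ha, hb, hab, hR⟩ := h.exists_mix_right hyz hxy
    exact ⟨b, a, hb, ha, by rwa [add_comm], by rwa [add_comm]⟩
  exists_mix_right hxy hyz := by
    obtain ⟨a, b, ha, hb, hab, hR⟩ := h.exists_mix_left hyz hxy
    exact ⟨b, a, hb, ha, by rwa [add_comm], by rwa [add_comm]⟩

theorem trans (h : IsVNMPreference K R) {x y z : V} (hxy : R x y) (hyz : R y z) : R x z :=
  (h.or_of_mem hxy (h.mem hyz).2).resolve_right (h.asymm hyz)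

theorem not_mix_of_better (h : IsVNMPreference K R) {w x y z : V} (hxy : ¬ R x y)
    (hx : x ∈ K) (hwy : R w y) (hwx : R w x) (hz : z ∈ K) {a b : ℝ} (ha : 0 < a) (hb : 0 < b)
    (hab : a + b = 1) : ¬ R (a • x + b • z) (a • y + b • z) := by
  intro hR
  obtain ⟨p, q, hp, hq, hpq, hpq'⟩ := h.exists_mix_right (h.mix hwx hz ha hb hab) hR
  have h1 : R (p • w + q • y) (p • y + q • y) := h.mix hwy (h.mem hwy).2 hp hq hpq
  rw [← add_smul, hpq, one_smul] at h1
  have h2 := h.mix ((h.or_of_mem h1 hx).resolve_right hxy) hz ha hb hab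
  refine h.asymm hpq' ?_
  convert h2 using 1
  have : q = 1 - p := by linarith
  subst this
  module

/-- Indifference is preserved under mixtures with a common third lottery. -/
theorem not_mix (h : IsVNMPreference K R) {x y z : V} (hxy : ¬ R x y) (hyx : ¬ R y x)
    (hx : x ∈ K) (hy : y ∈ K) (hz : z ∈ K) {a b : ℝ} (ha : 0 < a) (hb : 0 < b)
    (hab : a + b = 1) : ¬ R (a • x + b • z) (a • y + b • z) := by
  by_cases hw : ∃ w, R w x
  · obtain ⟨w, hw⟩ := hw
    exact h.not_mix_of_better hxy hx ((h.or_of_mem hw hy).resolve_right hyx) hw hz ha hb hab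
  by_cases hw' : ∃ w, R x w
  · obtain ⟨w, hw'⟩ := hw'
    exact h.swap.not_mix_of_better hxy hy hw' ((h.or_of_mem hw' hy).resolve_left hxy) hz ha hb hab
  intro hR
  rcases h.or_of_mem hR hx with h1 | h1
  exacts [hw ⟨_, h1⟩, hw' ⟨_, h1⟩]

theorem exists_mix_pref (h : IsVNMPreference K R) {x m z : V} (hxm : R x m) (hz : z ∈ K) :
    ∃ a b : ℝ, 0 < a ∧ 0 < b ∧ a + b = 1 ∧ R (a • x + b • z) m := by
  by_cases hmz : R m z
  · exact h.exists_mix_left hxm hmz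
  have hm := (h.mem hxm).2
  refine ⟨1 / 2, 1 / 2, by norm_num, by norm_num, by norm_num, ?_⟩
  have h1 : R ((1 / 2 : ℝ) • x + (1 / 2 : ℝ) • z) ((1 / 2 : ℝ) • m + (1 / 2 : ℝ) • z) :=
    h.mix hxm hz (by norm_num) (by norm_num) (by norm_num)
  have hmm : (1 / 2 : ℝ) • m + (1 / 2 : ℝ) • m = m := by module
  by_cases hzm : R z m
  · have h2 : R ((1 / 2 : ℝ) • z + (1 / 2 : ℝ) • m) ((1 / 2 : ℝ) • m + (1 / 2 : ℝ) • m) :=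
      h.mix hzm hm (by norm_num) (by norm_num) (by norm_num)
    rw [hmm, add_comm] at h2
    exact h.trans h1 h2
  · refine (h.or_of_mem h1 hm).resolve_right ?_
    have h2 : ¬ R ((1 / 2 : ℝ) • m + (1 / 2 : ℝ) • m) ((1 / 2 : ℝ) • z + (1 / 2 : ℝ) • m) :=
      h.not_mix hmz hzm hm hz hm (by norm_num) (by norm_num) (by norm_num)
    rwa [hmm, add_comm ((1 / 2 : ℝ) • z)] at h2

/-- The cone of directions of strict improvement. -/
def cone (h : IsVNMPreference K R) : ConvexCone ℝ V where
  carrier := {v | ∃ t : ℝ, 0 < t ∧ ∃ x y, R x y ∧ v = t • (x - y)}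
  smul_mem' := by
    rintro c hc _ ⟨t, ht, x, y, hxy, rfl⟩
    exact ⟨c * t, mul_pos hc ht, x, y, hxy, smul_smul _ _ _⟩
  add_mem' := by
    rintro _ ⟨s, hs, x, y, hxy, rfl⟩ _ ⟨t, ht, x', y', hxy', rfl⟩
    have hst : 0 < s + t := add_pos hs ht
    have hsum : s / (s + t) + t / (s + t) = 1 := by field_simp
    have h1 := h.mix hxy (h.mem hxy').1 (div_pos hs hst) (div_pos ht hst) hsum
    have h2 := h.mix hxy' (h.mem hxy).2 (div_pos ht hst) (div_pos hs hst)
      (by rwa [add_comm])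
    rw [add_comm, add_comm ((t / (s + t)) • y')] at h2
    refine ⟨s + t, hst, _, _, h.trans h1 h2, ?_⟩
    simp only [smul_sub, smul_add, smul_smul, mul_div_cancel₀ _ hst.ne']
    abel

theorem sub_mem_cone (h : IsVNMPreference K R) {x y : V} (hxy : R x y) : x - y ∈ h.cone :=
  ⟨1, one_pos, x, y, hxy, (one_smul _ _).symm⟩

theorem zero_notMem_cone (h : IsVNMPreference K R) : (0 : V) ∉ h.cone := by
  rintro ⟨t, ht, x, y, hxy, h0⟩
  obtain rfl := sub_eq_zero.1 ((smul_eq_zero.1 h0.symm).resolve_left ht.ne')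
  exact h.asymm hxy hxy

theorem exists_smul_sub_sub_mem_cone (h : IsVNMPreference K R) {x y x' y' : V} (hxy : R x y)
    (hxy' : R x' y') : ∃ n : ℝ, 0 < n ∧ n • (x - y) - (x' - y') ∈ h.cone := by
  obtain ⟨hx, hy⟩ := h.mem hxy
  obtain ⟨m, hm⟩ : ∃ m, m = (1 / 2 : ℝ) • x + (1 / 2 : ℝ) • y := ⟨_, rfl⟩
  have hxm : R x m := by
    have : R ((1 / 2 : ℝ) • x + (1 / 2 : ℝ) • x) ((1 / 2 : ℝ) • y + (1 / 2 : ℝ) • x) :=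
      h.mix hxy hx (by norm_num) (by norm_num) (by norm_num)
    convert this using 1
    · module
    · rw [hm, add_comm]
  have hmy : R m y := by
    have : R ((1 / 2 : ℝ) • x + (1 / 2 : ℝ) • y) ((1 / 2 : ℝ) • y + (1 / 2 : ℝ) • y) :=
      h.mix hxy hy (by norm_num) (by norm_num) (by norm_num)
    convert this using 1
    module
  obtain ⟨a, b, ha, hb, hab, h1⟩ := h.exists_mix_pref hxm (h.mem hxy').2
  obtain ⟨c, d, hc, hd, hcd, h2⟩ := h.swap.exists_mix_pref hmy (h.mem hxy').1
  have hmem := h.cone.add_mem (h.cone.smul_mem (inv_pos.2 hb) (h.sub_mem_cone h1))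
    (h.cone.smul_mem (inv_pos.2 hd) (h.sub_mem_cone h2))
  have hb1 : 1 < b⁻¹ := (one_lt_inv₀ hb).2 (by linarith)
  have hd1 : 1 < d⁻¹ := (one_lt_inv₀ hd).2 (by linarith)
  refine ⟨b⁻¹ / 2 + d⁻¹ / 2 - 1, by linarith, ?_⟩
  convert hmem using 1
  obtain rfl : a = 1 - b := by linarith
  obtain rfl : c = 1 - d := by linarith
  subst hm
  match_scalars <;> field_simp <;> ring

/-- The von Neumann–Morgenstern representation theorem on a convex set. -/
theorem exists_linearMap (h : IsVNMPreference K R) :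
    ∃ U : V →ₗ[ℝ] ℝ, ∀ x ∈ K, ∀ y ∈ K, R x y ↔ U y < U x := by
  obtain ⟨U, hU⟩ := h.cone.exists_pos_linearMap h.zero_notMem_cone (by
    rintro _ ⟨s, hs, x, y, hxy, rfl⟩ _ ⟨t, ht, x', y', hxy', rfl⟩
    obtain ⟨n, hn, hmem⟩ := h.exists_smul_sub_sub_mem_cone hxy hxy'
    refine ⟨t * n / s, by positivity, ?_⟩
    convert h.cone.smul_mem ht hmem using 1
    match_scalars <;> field_simp)
  have hlt : ∀ {x y}, R x y → U y < U x := fun {x y} hxy => by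
    simpa using hU _ (h.sub_mem_cone hxy)
  by_cases hR : ∃ z w, R z w
  swap
  · exact ⟨0, fun x _ y _ => by simpa using fun hxy => hR ⟨x, y, hxy⟩⟩
  obtain ⟨z, w, hzw⟩ := hR
  obtain ⟨hz, hw⟩ := h.mem hzw
  refine ⟨U, fun x hx y hy => ⟨hlt, fun hUxy => ?_⟩⟩
  by_contra hxy
  by_cases hyx : R y x
  · exact (hlt hyx).not_gt hUxy
  have key : ∀ a b : ℝ, 0 < a → 0 < b → a + b = 1 → 0 < a * (U y - U x) + b * (U z - U w) := by
    intro a b ha hb hab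
    have h1 : R (b • z + a • y) (b • w + a • y) := h.mix hzw hy hb ha (by linarith)
    have h2 := hlt ((h.or_of_mem h1 (h.convex hx hw ha.le hb.le hab)).resolve_right (by
      rw [add_comm (b • w)]
      exact h.not_mix hxy hyx hx hy hw ha hb hab))
    simp only [map_add, map_smul, smul_eq_mul] at h2
    linarith
  have hzw' := hlt hzw
  have hs : 0 < (U z - U w) + (U x - U y) := by linarith
  have := key ((U z - U w) / ((U z - U w) + (U x - U y))) ((U x - U y) / ((U z - U w) + (U x - U y)))
    (div_pos (by linarith) hs) (div_pos (by linarith) hs) (by field_simp)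
  refine this.ne' ?_
  field_simp
  ring

end IsVNMPreference

section Mix

variable {S : Type*} [MeasurableSpace S]

theorem isProbabilityMeasure_mix {μ ν : Measure S} [IsProbabilityMeasure μ]
    [IsProbabilityMeasure ν] {α : ℝ} (h0 : 0 ≤ α) (h1 : α ≤ 1) :
    IsProbabilityMeasure (mix α μ ν) := by
  constructor
  simp only [mix, Measure.coe_add, Measure.coe_smul, Pi.add_apply, Pi.smul_apply, measure_univ,
    smul_eq_mul, mul_one]
  rw [← ENNReal.ofReal_add h0 (by linarith)]
  simp

theorem toSignedMeasure_mix {μ ν : Measure S} [IsFiniteMeasure μ] [IsFiniteMeasure ν]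
    {α : ℝ} [IsFiniteMeasure (mix α μ ν)] (h0 : 0 ≤ α) (h1 : α ≤ 1) :
    (mix α μ ν).toSignedMeasure = α • μ.toSignedMeasure + (1 - α) • ν.toSignedMeasure := by
  have h : mix α μ ν = α.toNNReal • μ + (1 - α).toNNReal • ν := rfl
  rw [Measure.toSignedMeasure_congr h, Measure.toSignedMeasure_add, Measure.toSignedMeasure_smul,
    Measure.toSignedMeasure_smul, NNReal.smul_def, NNReal.smul_def, Real.coe_toNNReal _ h0,
    Real.coe_toNNReal _ (by linarith)]

end Mix

/-- von Neumann–Morgenstern affine representation: a total preorder on the probability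
measures on a Polish space satisfying the independence and Archimedean axioms admits a
linear functional on the space of finite signed (Borel, automatically regular) measures
whose restriction to the probability measures is a numerical representation. -/
theorem exists_affine_numerical_representation
    {S : Type*} [MeasurableSpace S] [TopologicalSpace S] [PolishSpace S] [BorelSpace S]
    (pref : Measure S → Measure S → Prop)
    (hrefl : ∀ μ : Measure S, IsProbabilityMeasure μ → pref μ μ)
    (htrans : ∀ μ ν ξ : Measure S, IsProbabilityMeasure μ → IsProbabilityMeasure ν →
      IsProbabilityMeasure ξ → pref μ ν → pref ν ξ → pref μ ξ)
    (htotal : ∀ μ ν : Measure S, IsProbabilityMeasure μ → IsProbabilityMeasure ν →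
      pref μ ν ∨ pref ν μ)
    (hind : ∀ μ ν ξ : Measure S, IsProbabilityMeasure μ → IsProbabilityMeasure ν →
      IsProbabilityMeasure ξ → StrictPref pref μ ν →
      ∀ α ∈ Set.Ioo (0:ℝ) 1, StrictPref pref (mix α μ ξ) (mix α ν ξ))
    (harch : ∀ μ ν ξ : Measure S, IsProbabilityMeasure μ → IsProbabilityMeasure ν →
      IsProbabilityMeasure ξ → StrictPref pref μ ν → StrictPref pref ν ξ →
      ∃ α ∈ Set.Ioo (0:ℝ) 1, ∃ β ∈ Set.Ioo (0:ℝ) 1,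
        StrictPref pref (mix α μ ξ) ν ∧ StrictPref pref ν (mix β μ ξ)) :
    ∃ U : SignedMeasure S →ₗ[ℝ] ℝ,
      ∀ (μ : Measure S) [IsProbabilityMeasure μ] (ν : Measure S) [IsProbabilityMeasure ν],
        StrictPref pref μ ν ↔ U μ.toSignedMeasure > U ν.toSignedMeasure := by
  let K : Set (SignedMeasure S) :=
    {v | ∃ (μ : Measure S) (_ : IsProbabilityMeasure μ), v = μ.toSignedMeasure}
  let R : SignedMeasure S → SignedMeasure S → Prop := fun v w =>
    ∃ (μ : Measure S) (_ : IsProbabilityMeasure μ) (ν : Measure S) (_ : IsProbabilityMeasure ν),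
      v = μ.toSignedMeasure ∧ w = ν.toSignedMeasure ∧ StrictPref pref μ ν
  have hR : ∀ (μ : Measure S) [IsProbabilityMeasure μ] (ν : Measure S) [IsProbabilityMeasure ν],
      R μ.toSignedMeasure ν.toSignedMeasure ↔ StrictPref pref μ ν := by
    intro μ _ ν _
    constructor
    · rintro ⟨μ', _, ν', _, hμ, hν, h⟩
      rw [Measure.toSignedMeasure_eq_toSignedMeasure_iff] at hμ hν
      rwa [hμ, hν]
    · exact fun h => ⟨μ, ‹_›, ν, ‹_›, rfl, rfl, h⟩
  have hmix : ∀ (μ : Measure S) [IsProbabilityMeasure μ] (ν : Measure S) [IsProbabilityMeasure ν]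
      {a b : ℝ}, 0 ≤ a → 0 ≤ b → a + b = 1 → ∃ _ : IsProbabilityMeasure (mix a μ ν),
        a • μ.toSignedMeasure + b • ν.toSignedMeasure = (mix a μ ν).toSignedMeasure := by
    intro μ _ ν _ a b ha hb hab
    have := isProbabilityMeasure_mix (μ := μ) (ν := ν) ha (by linarith)
    refine ⟨this, ?_⟩
    rw [toSignedMeasure_mix ha (by linarith), ← hab, add_sub_cancel_left]
  have hvnm : IsVNMPreference K R := by
    refine ⟨?_, ?_, ?_, ?_, ?_, ?_, ?_⟩
    · rintro _ ⟨μ, _, rfl⟩ _ ⟨ν, _, rfl⟩ a b ha hb hab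
      obtain ⟨hP, h⟩ := hmix μ ν ha hb hab
      exact ⟨_, hP, h⟩
    · rintro _ _ ⟨μ, _, ν, _, rfl, rfl, -⟩
      exact ⟨⟨μ, ‹_›, rfl⟩, ⟨ν, ‹_›, rfl⟩⟩
    · rintro _ _ ⟨μ, _, ν, _, rfl, rfl, h⟩
      rw [hR]
      exact fun h' => h.2 h'.1
    · rintro _ _ _ ⟨μ, _, ν, _, rfl, rfl, h⟩ ⟨ξ, _, rfl⟩
      rw [hR, hR]
      by_cases h1 : pref ξ μ
      · refine Or.inr ⟨htrans ξ μ ν ‹_› ‹_› ‹_› h1 h.1, fun h2 => ?_⟩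
        exact h.2 (htrans ν ξ μ ‹_› ‹_› ‹_› h2 h1)
      · exact Or.inl ⟨(htotal μ ξ ‹_› ‹_›).resolve_right h1, h1⟩
    · rintro _ _ _ ⟨μ, _, ν, _, rfl, rfl, h⟩ ⟨ξ, _, rfl⟩ a b ha hb hab
      obtain ⟨_, e1⟩ := hmix μ ξ ha.le hb.le hab
      obtain ⟨_, e2⟩ := hmix ν ξ ha.le hb.le hab
      rw [e1, e2, hR]
      exact hind μ ν ξ ‹_› ‹_› ‹_› h a ⟨ha, by linarith⟩
    · rintro _ _ _ ⟨μ, _, ν, _, rfl, rfl, h⟩ ⟨ν', _, ξ, _, hν, rfl, h'⟩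
      obtain rfl := (Measure.toSignedMeasure_eq_toSignedMeasure_iff).1 hν
      obtain ⟨α, hα, -, -, hmem, -⟩ := harch μ ν ξ ‹_› ‹_› ‹_› h h'
      obtain ⟨_, e⟩ := hmix μ ξ hα.1.le (sub_nonneg.2 hα.2.le) (add_sub_cancel _ _)
      refine ⟨α, 1 - α, hα.1, sub_pos.2 hα.2, add_sub_cancel _ _, ?_⟩
      rwa [e, hR]
    · rintro _ _ _ ⟨μ, _, ν, _, rfl, rfl, h⟩ ⟨ν', _, ξ, _, hν, rfl, h'⟩
      obtain rfl := (Measure.toSignedMeasure_eq_toSignedMeasure_iff).1 hν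
      obtain ⟨-, -, β, hβ, -, hmem⟩ := harch μ ν ξ ‹_› ‹_› ‹_› h h'
      obtain ⟨_, e⟩ := hmix μ ξ hβ.1.le (sub_nonneg.2 hβ.2.le) (add_sub_cancel _ _)
      refine ⟨β, 1 - β, hβ.1, sub_pos.2 hβ.2, add_sub_cancel _ _, ?_⟩
      rwa [e, hR]
  obtain ⟨U, hU⟩ := hvnm.exists_linearMap
  refine ⟨U, fun μ _ ν _ => ?_⟩
  rw [← hR, hU _ ⟨μ, ‹_›, rfl⟩ _ ⟨ν, ‹_›, rfl⟩]
end

section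
/- Let S be a Polish space and P(S) the set of Borel probability measures on S, endowed with the topology of weak convergence of measures. Suppose a total preorder ⪯ on P(S) is continuous (for every μ ∈ P(S), the sets {ν : ν ⪯ μ} and {ν : μ ⪯ ν} are closed in the weak topology) and satisfies the independence axiom. Then there exists a continuous bounded function u : S → ℝ such that the functional U(μ) = ∫_S u(z) dμ(z) is a numerical representation of ⪯ on P(S). -/
open MeasureTheory

/-- Convex combination (lottery) of two probability measures. -/
noncomputable def pmix {S : Type*} [MeasurableSpace S] (α : ℝ) (h0 : 0 ≤ α) (h1 : α ≤ 1)
    (μ ν : ProbabilityMeasure S) : ProbabilityMeasure S :=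
  ⟨ENNReal.ofReal α • (μ : Measure S) + ENNReal.ofReal (1 - α) • (ν : Measure S), by
    constructor
    have h2 : (0:ℝ) ≤ 1 - α := by linarith
    simp only [Measure.coe_add, Measure.coe_smul, Pi.add_apply, Pi.smul_apply,
      measure_univ, smul_eq_mul, mul_one]
    rw [← ENNReal.ofReal_add h0 h2]
    norm_num⟩

open Filter Topology Set

lemma exists_seq_weights_tendsto_zero :
    ∃ t : ℕ → ℝ, (∀ n, 0 < t n) ∧ (∀ n, t n < 1) ∧ Tendsto t atTop (𝓝 0) := by
  obtain ⟨t, -, ht, hlim⟩ := exists_seq_strictAnti_tendsto' (zero_lt_one (α := ℝ))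
  exact ⟨t, fun n => (ht n).1, fun n => (ht n).2, hlim⟩

section Mixtures

variable {S : Type*} [MeasurableSpace S]

lemma probabilityMeasure_ext_real {μ ν : ProbabilityMeasure S}
    (h : ∀ A, MeasurableSet A → (μ A : ℝ) = ν A) : μ = ν :=
  ProbabilityMeasure.eq_of_forall_apply_eq μ ν fun A hA => NNReal.eq (h A hA)

lemma pmix_apply (α : ℝ) (h0 : 0 ≤ α) (h1 : α ≤ 1) (μ ν : ProbabilityMeasure S) (A : Set S) :
    ((pmix α h0 h1 μ ν A : NNReal) : ℝ) = α * μ A + (1 - α) * ν A := by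
  have h2 : (0 : ℝ) ≤ 1 - α := sub_nonneg.2 h1
  simp only [← ProbabilityMeasure.measureReal_eq_coe_coeFn]
  simp only [pmix, ProbabilityMeasure.coe_mk, Measure.real, Measure.coe_add, Measure.coe_smul,
    Pi.add_apply, Pi.smul_apply, smul_eq_mul]
  rw [ENNReal.toReal_add (by finiteness) (by finiteness), ENNReal.toReal_mul, ENNReal.toReal_mul,
    ENNReal.toReal_ofReal h0, ENNReal.toReal_ofReal h2]

lemma integral_pmix (α : ℝ) (h0 : 0 ≤ α) (h1 : α ≤ 1) (μ ν : ProbabilityMeasure S) {f : S → ℝ}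
    (hμ : Integrable f (μ : Measure S)) (hν : Integrable f (ν : Measure S)) :
    ∫ x, f x ∂(pmix α h0 h1 μ ν : Measure S)
      = α * ∫ x, f x ∂(μ : Measure S) + (1 - α) * ∫ x, f x ∂(ν : Measure S) := by
  have h2 : (0 : ℝ) ≤ 1 - α := sub_nonneg.2 h1
  simp only [pmix, ProbabilityMeasure.coe_mk]
  rw [integral_add_measure (hμ.smul_measure ENNReal.ofReal_ne_top)
    (hν.smul_measure ENNReal.ofReal_ne_top), integral_smul_measure, integral_smul_measure,
    ENNReal.toReal_ofReal h0, ENNReal.toReal_ofReal h2, smul_eq_mul, smul_eq_mul]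

lemma pmix_self (α : ℝ) (h0 : 0 ≤ α) (h1 : α ≤ 1) (μ : ProbabilityMeasure S) :
    pmix α h0 h1 μ μ = μ :=
  probabilityMeasure_ext_real fun A _ => by rw [pmix_apply]; ring

lemma pmix_symm (α : ℝ) (h0 : 0 ≤ α) (h1 : α ≤ 1) (μ ν : ProbabilityMeasure S) :
    pmix α h0 h1 μ ν = pmix (1 - α) (sub_nonneg.2 h1) (sub_le_self 1 h0) ν μ :=
  probabilityMeasure_ext_real fun A _ => by simp only [pmix_apply]; ring

lemma pmix_zero (h0 : (0 : ℝ) ≤ 0) (h1 : (0 : ℝ) ≤ 1) (μ ν : ProbabilityMeasure S) :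
    pmix 0 h0 h1 μ ν = ν :=
  probabilityMeasure_ext_real fun A _ => by rw [pmix_apply]; ring

lemma pmix_one (h0 : (0 : ℝ) ≤ 1) (h1 : (1 : ℝ) ≤ 1) (μ ν : ProbabilityMeasure S) :
    pmix 1 h0 h1 μ ν = μ :=
  probabilityMeasure_ext_real fun A _ => by rw [pmix_apply]; ring

/-- Mixing with a fixed `ξ` commutes with taking mixtures. -/
lemma pmix_pmix_left (α s : ℝ) (h0 : 0 ≤ α) (h1 : α ≤ 1) (k0 : 0 ≤ s) (k1 : s ≤ 1)
    (μ ν ξ : ProbabilityMeasure S) :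
    pmix α h0 h1 (pmix s k0 k1 μ ν) ξ
      = pmix s k0 k1 (pmix α h0 h1 μ ξ) (pmix α h0 h1 ν ξ) :=
  probabilityMeasure_ext_real fun A _ => by simp only [pmix_apply]; ring

/-- A mixture of two points of the segment from `b` to `a` is a point of this segment. -/
lemma pmix_pmix_pmix (α s t : ℝ) (h0 : 0 ≤ α) (h1 : α ≤ 1) (s0 : 0 ≤ s) (s1 : s ≤ 1)
    (t0 : 0 ≤ t) (t1 : t ≤ 1) (a b : ProbabilityMeasure S)
    (r0 : 0 ≤ α * s + (1 - α) * t) (r1 : α * s + (1 - α) * t ≤ 1) :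
    pmix α h0 h1 (pmix s s0 s1 a b) (pmix t t0 t1 a b)
      = pmix (α * s + (1 - α) * t) r0 r1 a b :=
  probabilityMeasure_ext_real fun A _ => by simp only [pmix_apply]; ring

variable [TopologicalSpace S] [OpensMeasurableSpace S]

lemma integral_pmix_boundedContinuousFunction (α : ℝ) (h0 : 0 ≤ α) (h1 : α ≤ 1)
    (μ ν : ProbabilityMeasure S) (f : BoundedContinuousFunction S ℝ) :
    ∫ x, f x ∂(pmix α h0 h1 μ ν : Measure S)
      = α * ∫ x, f x ∂(μ : Measure S) + (1 - α) * ∫ x, f x ∂(ν : Measure S) :=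
  integral_pmix α h0 h1 μ ν (f.integrable _) (f.integrable _)

/-- If the weights tend to zero, the mixtures converge weakly, uniformly in the first measure. -/
lemma tendsto_pmix_zero {ι : Type*} {l : Filter ι} {t : ι → ℝ} (h0 : ∀ i, 0 ≤ t i)
    (h1 : ∀ i, t i ≤ 1) (ht : Tendsto t l (𝓝 0)) (μ : ι → ProbabilityMeasure S)
    (ν : ProbabilityMeasure S) :
    Tendsto (fun i => pmix (t i) (h0 i) (h1 i) (μ i) ν) l (𝓝 ν) := by
  rw [ProbabilityMeasure.tendsto_iff_forall_integral_tendsto]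
  intro f
  simp only [integral_pmix_boundedContinuousFunction]
  have hb : ∀ i, ‖∫ x, f x ∂(μ i : Measure S)‖ ≤ ‖f‖ := fun i =>
    f.norm_integral_le_norm _
  have h3 : Tendsto (fun i => t i * ∫ x, f x ∂(μ i : Measure S)) l (𝓝 0) :=
    ht.zero_mul_isBoundedUnder_le (isBoundedUnder_of ⟨‖f‖, hb⟩)
  have h4 : Tendsto (fun i => (1 - t i) * ∫ x, f x ∂(ν : Measure S)) l
      (𝓝 ((1 - 0) * ∫ x, f x ∂(ν : Measure S))) := (tendsto_const_nhds.sub ht).mul_const _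
  simpa using h3.add h4

lemma continuous_pmix_weight (a b : ProbabilityMeasure S) :
    Continuous fun t : Icc (0 : ℝ) 1 => pmix t t.2.1 t.2.2 a b := by
  rw [ProbabilityMeasure.continuous_iff_forall_continuous_integral]
  intro f
  simp only [integral_pmix_boundedContinuousFunction]
  fun_prop

lemma continuous_pmix_left (α : ℝ) (h0 : 0 ≤ α) (h1 : α ≤ 1) (ξ : ProbabilityMeasure S) :
    Continuous fun μ : ProbabilityMeasure S => pmix α h0 h1 μ ξ := by
  rw [ProbabilityMeasure.continuous_iff_forall_continuous_integral]
  intro f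
  simp only [integral_pmix_boundedContinuousFunction]
  exact ((ProbabilityMeasure.continuous_integral_boundedContinuousFunction f).const_mul α).add
    continuous_const

end Mixtures

/-- Continuous total preorders on lotteries that satisfy the independence axiom. -/
structure IsContinuousIndependent {S : Type*} [MeasurableSpace S] [TopologicalSpace S]
    [OpensMeasurableSpace S]
    (pref : ProbabilityMeasure S → ProbabilityMeasure S → Prop) : Prop where
  trans : ∀ {μ ν ξ}, pref μ ν → pref ν ξ → pref μ ξ
  total : ∀ μ ν, pref μ ν ∨ pref ν μ
  isClosed_lower : ∀ μ, IsClosed {ν | pref μ ν}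
  isClosed_upper : ∀ μ, IsClosed {ν | pref ν μ}
  independence : ∀ {μ ν : ProbabilityMeasure S} (ξ : ProbabilityMeasure S), StrictPref pref μ ν →
    ∀ (α : ℝ) (hα0 : 0 < α) (hα1 : α < 1),
      StrictPref pref (pmix α hα0.le hα1.le μ ξ) (pmix α hα0.le hα1.le ν ξ)

namespace IsContinuousIndependent

variable {S : Type*} [MeasurableSpace S] [TopologicalSpace S] [OpensMeasurableSpace S]
  {pref : ProbabilityMeasure S → ProbabilityMeasure S → Prop}

lemma refl (H : IsContinuousIndependent pref) (μ : ProbabilityMeasure S) : pref μ μ :=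
  (H.total μ μ).elim id id

lemma strict_of_not (H : IsContinuousIndependent pref) {μ ν : ProbabilityMeasure S}
    (h : ¬ pref ν μ) : StrictPref pref μ ν :=
  ⟨(H.total μ ν).resolve_right h, h⟩

lemma strict_trans_weak (H : IsContinuousIndependent pref) {μ ν ξ : ProbabilityMeasure S}
    (h : StrictPref pref μ ν) (h' : pref ν ξ) : StrictPref pref μ ξ :=
  ⟨H.trans h.1 h', fun k => h.2 (H.trans h' k)⟩

lemma weak_trans_strict (H : IsContinuousIndependent pref) {μ ν ξ : ProbabilityMeasure S}
    (h : pref μ ν) (h' : StrictPref pref ν ξ) : StrictPref pref μ ξ :=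
  ⟨H.trans h h'.1, fun k => h'.2 (H.trans k h)⟩

/-- The independence axiom with the common lottery in the first place. -/
lemma independence_right (H : IsContinuousIndependent pref) {μ ν : ProbabilityMeasure S}
    (ξ : ProbabilityMeasure S) (h : StrictPref pref μ ν) (α : ℝ) (h0 : 0 < α) (h1 : α < 1) :
    StrictPref pref (pmix α h0.le h1.le ξ μ) (pmix α h0.le h1.le ξ ν) := by
  rw [pmix_symm α _ _ ξ μ, pmix_symm α _ _ ξ ν]
  exact H.independence ξ h (1 - α) (by linarith) (by linarith)

lemma mem_of_forall_pmix_mem {K : Set (ProbabilityMeasure S)} (hK : IsClosed K)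
    {p q : ProbabilityMeasure S}
    (h : ∀ (s : ℝ) (h0 : 0 < s) (h1 : s < 1), pmix s h0.le h1.le p q ∈ K) : q ∈ K := by
  obtain ⟨t, h0, h1, ht⟩ := exists_seq_weights_tendsto_zero
  exact hK.mem_of_tendsto
    (tendsto_pmix_zero (fun n => (h0 n).le) (fun n => (h1 n).le) ht (fun _ => p) q)
    (Eventually.of_forall fun n => h _ (h0 n) (h1 n))

lemma pref_pmix_of_indifferent (H : IsContinuousIndependent pref) {μ ν : ProbabilityMeasure S}
    (ξ : ProbabilityMeasure S) (h : pref μ ν) (h' : pref ν μ) (α : ℝ) (h0 : 0 < α) (h1 : α < 1) :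
    pref (pmix α h0.le h1.le μ ξ) (pmix α h0.le h1.le ν ξ) := by
  by_contra hn
  have hs := H.strict_of_not hn
  set a := pmix α h0.le h1.le ν ξ with ha
  set b := pmix α h0.le h1.le μ ξ with hb
  apply hn
  by_cases hμa : pref μ a
  · have hνb : StrictPref pref ν b := H.weak_trans_strict (H.trans h' hμa) hs
    refine mem_of_forall_pmix_mem (H.isClosed_lower b) (p := pmix α h0.le h1.le b ξ) ?_
    intro s s0 s1
    have h2 := H.independence ν hνb s s0 s1
    rw [pmix_self] at h2
    have h3 := (H.independence ξ (H.weak_trans_strict h h2) α h0 h1).1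
    rwa [pmix_pmix_left] at h3
  · have haμ : StrictPref pref a μ := H.strict_of_not hμa
    refine mem_of_forall_pmix_mem (H.isClosed_upper a) (p := pmix α h0.le h1.le a ξ) ?_
    intro s s0 s1
    have h2 := H.independence μ haμ s s0 s1
    rw [pmix_self] at h2
    have h3 := (H.independence ξ (H.strict_trans_weak h2 h) α h0 h1).1
    rwa [pmix_pmix_left] at h3

/-- The independence axiom for weak preference. -/
lemma pref_pmix (H : IsContinuousIndependent pref) {μ ν : ProbabilityMeasure S}
    (ξ : ProbabilityMeasure S) (h : pref μ ν) (α : ℝ) (h0 : 0 ≤ α) (h1 : α ≤ 1) :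
    pref (pmix α h0 h1 μ ξ) (pmix α h0 h1 ν ξ) := by
  rcases h0.eq_or_lt with rfl | h0'
  · rw [pmix_zero, pmix_zero]
    exact H.refl ξ
  rcases h1.eq_or_lt with rfl | h1'
  · rwa [pmix_one, pmix_one]
  by_cases h' : pref ν μ
  · exact H.pref_pmix_of_indifferent ξ h h' α h0' h1'
  · exact (H.independence ξ ⟨h, h'⟩ α h0' h1').1

lemma pref_pmix_pmix (H : IsContinuousIndependent pref) {μ ν μ' ν' : ProbabilityMeasure S}
    (h : pref μ ν) (h' : pref μ' ν') (α : ℝ) (h0 : 0 ≤ α) (h1 : α ≤ 1) :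
    pref (pmix α h0 h1 μ μ') (pmix α h0 h1 ν ν') := by
  refine H.trans (H.pref_pmix μ' h α h0 h1) ?_
  rw [pmix_symm α _ _ ν μ', pmix_symm α _ _ ν ν']
  exact H.pref_pmix ν h' _ _ _

lemma pref_pmix_iff (H : IsContinuousIndependent pref) (μ ν ξ : ProbabilityMeasure S)
    (α : ℝ) (h0 : 0 < α) (h1 : α < 1) :
    pref (pmix α h0.le h1.le μ ξ) (pmix α h0.le h1.le ν ξ) ↔ pref μ ν := by
  refine ⟨fun h => ?_, fun h => H.pref_pmix ξ h α _ _⟩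
  by_contra hn
  exact (H.independence ξ (H.strict_of_not hn) α h0 h1).2 h

/-- Along the segment from `b` to a better `a`, preference is strictly increasing. -/
lemma strictPref_segment (H : IsContinuousIndependent pref) {a b : ProbabilityMeasure S}
    (hab : StrictPref pref a b) {s t : ℝ} (s0 : 0 ≤ s) (s1 : s ≤ 1) (t0 : 0 ≤ t) (t1 : t ≤ 1)
    (hts : t < s) : StrictPref pref (pmix s s0 s1 a b) (pmix t t0 t1 a b) := by
  have hs : 0 < s := t0.trans_lt hts
  have hb : StrictPref pref (pmix s s0 s1 a b) b := by
    rcases s1.eq_or_lt with rfl | s1'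
    · rwa [pmix_one]
    · have h := H.independence b hab s hs s1'
      rwa [pmix_self] at h
  rcases t0.eq_or_lt with rfl | t0'
  · rwa [pmix_zero]
  have h := H.independence_right (pmix s s0 s1 a b) hb (t / s) (div_pos t0' hs)
    ((div_lt_one hs).2 hts)
  rw [pmix_self] at h
  convert h using 1
  refine probabilityMeasure_ext_real fun A _ => ?_
  simp only [pmix_apply]
  field_simp
  ring

lemma pref_segment_iff (H : IsContinuousIndependent pref) {a b : ProbabilityMeasure S}
    (hab : StrictPref pref a b) {s t : ℝ} (s0 : 0 ≤ s) (s1 : s ≤ 1) (t0 : 0 ≤ t) (t1 : t ≤ 1) :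
    pref (pmix s s0 s1 a b) (pmix t t0 t1 a b) ↔ t ≤ s := by
  refine ⟨fun h => ?_, fun h => ?_⟩
  · by_contra hn
    exact (H.strictPref_segment hab t0 t1 s0 s1 (not_le.1 hn)).2 h
  · rcases h.eq_or_lt with rfl | h
    · exact H.refl _
    · exact (H.strictPref_segment hab s0 s1 t0 t1 h).1

/-- Every lottery between `b` and `a` is indifferent to a mixture of them. -/
lemma exists_indifferent_pmix (H : IsContinuousIndependent pref) {a b p : ProbabilityMeasure S}
    (hap : pref a p) (hpb : pref p b) :
    ∃ (t : ℝ) (t0 : 0 ≤ t) (t1 : t ≤ 1),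
      pref (pmix t t0 t1 a b) p ∧ pref p (pmix t t0 t1 a b) := by
  have hc := continuous_pmix_weight a b
  have h := isPreconnected_closed_iff.1 (isPreconnected_univ (α := Icc (0 : ℝ) 1)) _ _
    ((H.isClosed_upper p).preimage hc) ((H.isClosed_lower p).preimage hc)
    (fun t _ => H.total _ _)
    ⟨⟨1, by simp⟩, mem_univ _, by simpa [pmix_one] using hap⟩
    ⟨⟨0, by simp⟩, mem_univ _, by simpa [pmix_zero] using hpb⟩
  obtain ⟨t, -, h1, h2⟩ := h
  exact ⟨t, t.2.1, t.2.2, h1, h2⟩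

/-- A uniform contraction towards `c` brings all lotteries between `b` and `a`. -/
lemma exists_pmix_between (H : IsContinuousIndependent pref) {a b c : ProbabilityMeasure S}
    (hac : StrictPref pref a c) (hcb : StrictPref pref c b) :
    ∃ (ε : ℝ) (h0 : 0 < ε) (h1 : ε < 1), ∀ μ,
      pref a (pmix ε h0.le h1.le μ c) ∧ pref (pmix ε h0.le h1.le μ c) b := by
  by_contra! hn
  obtain ⟨t, h0, h1, ht⟩ := exists_seq_weights_tendsto_zero
  choose μ hμ using fun n => hn _ (h0 n) (h1 n)
  have hlim := tendsto_pmix_zero (fun n => (h0 n).le) (fun n => (h1 n).le) ht μ c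
  have e1 := hlim.eventually ((H.isClosed_upper a).isOpen_compl.mem_nhds hac.2)
  have e2 := hlim.eventually ((H.isClosed_lower b).isOpen_compl.mem_nhds hcb.2)
  obtain ⟨n, k1, k2⟩ := (e1.and e2).exists
  exact hμ n (H.strict_of_not k1).1 (H.strict_of_not k2).1

/-- A continuous preference satisfying independence has a bounded continuous representation
that is affine with respect to mixtures. -/
theorem exists_affine_representation (H : IsContinuousIndependent pref) :
    ∃ U : ProbabilityMeasure S → ℝ, Continuous U ∧ (∀ μ, |U μ| ≤ 1) ∧
      (∀ (α : ℝ) (h0 : 0 ≤ α) (h1 : α ≤ 1) (μ ν : ProbabilityMeasure S),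
        U (pmix α h0 h1 μ ν) = α * U μ + (1 - α) * U ν) ∧
      ∀ μ ν, pref μ ν ↔ U ν ≤ U μ := by
  by_cases hex : ∃ a b, StrictPref pref a b
  swap
  · refine ⟨fun _ => 0, continuous_const, by simp, by simp, fun μ ν => ?_⟩
    simp only [le_refl, iff_true]
    by_contra hn
    exact hex ⟨ν, μ, H.strict_of_not hn⟩
  obtain ⟨a, b, hab⟩ := hex
  have hac : StrictPref pref a (pmix (1 / 2) (by norm_num) (by norm_num) a b) := by
    have h := H.strictPref_segment hab (s := 1) (t := 1 / 2) (by norm_num) (by norm_num)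
      (by norm_num) (by norm_num) (by norm_num)
    rwa [pmix_one] at h
  have hcb : StrictPref pref (pmix (1 / 2) (by norm_num) (by norm_num) a b) b := by
    have h := H.strictPref_segment hab (s := 1 / 2) (t := 0) (by norm_num) (by norm_num)
      (by norm_num) (by norm_num) (by norm_num)
    rwa [pmix_zero] at h
  obtain ⟨ε, ε0, ε1, hε⟩ := H.exists_pmix_between hac hcb
  set c := pmix (1 / 2) (by norm_num) (by norm_num) a b
  choose U U0 U1 hU hU' using fun μ => H.exists_indifferent_pmix (hε μ).1 (hε μ).2
  refine ⟨U, ?_, fun μ => abs_le.2 ⟨by linarith [U0 μ], U1 μ⟩, fun α h0 h1 μ ν => ?_,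
    fun μ ν => ?_⟩
  · have hφ := continuous_pmix_left ε ε0.le ε1.le c
    rw [OrderTopology.continuous_iff]
    refine fun x => ⟨?_, ?_⟩
    · rw [← isClosed_compl_iff]
      rcases lt_or_ge x 0 with hx0 | hx0
      · convert isClosed_empty
        ext μ
        simpa using hx0.trans_le (U0 μ)
      rcases lt_or_ge 1 x with hx1 | hx1
      · convert isClosed_univ
        ext μ
        simpa using (U1 μ).trans hx1.le
      convert (H.isClosed_lower (pmix x hx0 hx1 a b)).preimage hφ using 1
      ext μ
      simp only [mem_compl_iff, mem_preimage, mem_Ioi, not_lt, mem_ofPred_eq]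
      rw [← H.pref_segment_iff hab hx0 hx1 (U0 μ) (U1 μ)]
      exact ⟨fun h => H.trans h (hU μ), fun h => H.trans h (hU' μ)⟩
    · rw [← isClosed_compl_iff]
      rcases lt_or_ge x 0 with hx0 | hx0
      · convert isClosed_univ
        ext μ
        simpa using hx0.le.trans (U0 μ)
      rcases lt_or_ge 1 x with hx1 | hx1
      · convert isClosed_empty
        ext μ
        simpa using (U1 μ).trans_lt hx1
      convert (H.isClosed_upper (pmix x hx0 hx1 a b)).preimage hφ using 1
      ext μ
      simp only [mem_compl_iff, mem_preimage, mem_Iio, not_lt, mem_ofPred_eq]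
      rw [← H.pref_segment_iff hab (U0 μ) (U1 μ) hx0 hx1]
      exact ⟨fun h => H.trans (hU' μ) h, fun h => H.trans (hU μ) h⟩
  · have r0 : 0 ≤ α * U μ + (1 - α) * U ν :=
      add_nonneg (mul_nonneg h0 (U0 μ)) (mul_nonneg (sub_nonneg.2 h1) (U0 ν))
    have r1 : α * U μ + (1 - α) * U ν ≤ 1 := by
      nlinarith [mul_le_mul_of_nonneg_left (U1 μ) h0,
        mul_le_mul_of_nonneg_left (U1 ν) (sub_nonneg.2 h1)]
    have k := H.pref_pmix_pmix (hU μ) (hU ν) α h0 h1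
    have k' := H.pref_pmix_pmix (hU' μ) (hU' ν) α h0 h1
    rw [pmix_pmix_pmix (r0 := r0) (r1 := r1), ← pmix_pmix_left] at k k'
    refine le_antisymm ?_ ?_
    · exact (H.pref_segment_iff hab r0 r1 (U0 _) (U1 _)).1 (H.trans k (hU' _))
    · exact (H.pref_segment_iff hab (U0 _) (U1 _) r0 r1).1 (H.trans (hU _) k')
  · rw [← H.pref_pmix_iff μ ν c ε ε0 ε1, ← H.pref_segment_iff hab (U0 μ) (U1 μ) (U0 ν) (U1 ν)]
    exact ⟨fun h => H.trans (hU μ) (H.trans h (hU' ν)), fun h => H.trans (hU' μ) (H.trans h (hU ν))⟩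

end IsContinuousIndependent

section Integral

/-- An affine functional agrees with the integral of its values at Dirac masses on all finitely
supported probability measures. -/
lemma affine_eq_integral_of_finite_support {S : Type*} [MeasurableSpace S]
    [MeasurableSingletonClass S] {U : ProbabilityMeasure S → ℝ}
    (hU : ∀ (α : ℝ) (h0 : 0 ≤ α) (h1 : α ≤ 1) (μ ν : ProbabilityMeasure S),
      U (pmix α h0 h1 μ ν) = α * U μ + (1 - α) * U ν) (s : Finset S) :
    ∀ μ : ProbabilityMeasure S, (μ : Measure S) (s : Set S)ᶜ = 0 →
      U μ = ∫ x, U (diracProba x) ∂(μ : Measure S) := by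
  classical
  induction s using Finset.induction_on with
  | empty => intro μ hμ; simp at hμ
  | insert z s hz ih =>
    intro μ hμ
    have hint : ∀ (ν : ProbabilityMeasure S), (ν : Measure S) (s : Set S)ᶜ = 0 →
        Integrable (fun x => U (diracProba x)) (ν : Measure S) := by
      intro ν hν
      rw [← Measure.restrict_eq_self_of_ae_mem (s := (s : Set S)) (μ := (ν : Measure S)) hν]
      exact IntegrableOn.finset
    have hm : MeasurableSet ({z} : Set S) := measurableSet_singleton z
    by_cases hc : (μ : Measure S) {z}ᶜ = 0
    · have hμz : μ = diracProba z := by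
        have h1 : (μ : Measure S) = Measure.dirac z := by
          rw [← Measure.restrict_eq_self_of_ae_mem (s := ({z} : Set S)) (μ := (μ : Measure S)) hc,
            Measure.restrict_singleton, (prob_compl_eq_zero_iff hm).1 hc, one_smul]
        exact Subtype.ext h1
      rw [hμz]
      simp [diracProba]
    · have := ProbabilityTheory.cond_isProbabilityMeasure hc
      let ν : ProbabilityMeasure S := ⟨ProbabilityTheory.cond (μ : Measure S) {z}ᶜ, this⟩
      have hν : (ν : Measure S) (s : Set S)ᶜ = 0 := by
        change ProbabilityTheory.cond (μ : Measure S) {z}ᶜ _ = 0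
        rw [ProbabilityTheory.cond_apply hm.compl]
        have : ({z}ᶜ ∩ (s : Set S)ᶜ) = ((insert z s : Finset S) : Set S)ᶜ := by
          ext x; simp
        rw [this, hμ, mul_zero]
      have hmix : μ = pmix (μ {z}) (by positivity) (by exact_mod_cast μ.apply_le_one {z})
          (diracProba z) ν := by
        refine probabilityMeasure_ext_real fun A hA => ?_
        have hcz : (1 : ℝ) - μ {z} = (μ : Measure S).real {z}ᶜ := by
          rw [probReal_compl_eq_one_sub hm, ProbabilityMeasure.measureReal_eq_coe_coeFn]
        have hνA : ((μ : Measure S).real {z}ᶜ) * (ν A : ℝ) = (μ : Measure S).real ({z}ᶜ ∩ A) := by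
          rw [← ProbabilityMeasure.measureReal_eq_coe_coeFn, mul_comm]
          have h := congrArg ENNReal.toReal
            (ProbabilityTheory.cond_mul_eq_inter hm.compl A (μ : Measure S))
          rwa [ENNReal.toReal_mul] at h
        rw [pmix_apply, hcz, hνA, ← ProbabilityMeasure.measureReal_eq_coe_coeFn,
          ← ProbabilityMeasure.measureReal_eq_coe_coeFn,
          ← ProbabilityMeasure.measureReal_eq_coe_coeFn]
        have hsplit := measureReal_inter_add_sdiff (μ := (μ : Measure S)) (s := A) hm
        rw [← hsplit, sdiff_eq, inter_comm A {z}ᶜ]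
        congr 1
        by_cases hzA : z ∈ A
        · simp [Measure.real, hzA, inter_eq_right.2 (singleton_subset_iff.2 hzA)]
        · simp [Measure.real, hzA, inter_singleton_eq_empty.2 hzA]
      have hd : Integrable (fun x => U (diracProba x)) (diracProba z : Measure S) :=
        integrable_dirac (by simp)
      rw [hmix, hU, integral_pmix _ _ _ _ _ hd (hint ν hν), ih ν hν]
      simp [diracProba]

/-- A continuous affine functional is the integral of its values at Dirac masses. -/
theorem affine_eq_integral {S : Type*} [MeasurableSpace S] [TopologicalSpace S] [PolishSpace S]
    [BorelSpace S] {U : ProbabilityMeasure S → ℝ} (hc : Continuous U) {C : ℝ}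
    (hb : ∀ μ, |U μ| ≤ C)
    (hU : ∀ (α : ℝ) (h0 : 0 ≤ α) (h1 : α ≤ 1) (μ ν : ProbabilityMeasure S),
      U (pmix α h0 h1 μ ν) = α * U μ + (1 - α) * U ν) (μ : ProbabilityMeasure S) :
    U μ = ∫ x, U (diracProba x) ∂(μ : Measure S) := by
  let := TopologicalSpace.pseudoMetrizableSpacePseudoMetric S
  obtain ⟨x₀⟩ := μ.nonempty
  let f : ℕ → SimpleFunc S S := SimpleFunc.approxOn id measurable_id univ x₀ (mem_univ _)
  have hf : ∀ x, Tendsto (fun n => f n x) atTop (𝓝 x) := fun x =>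
    SimpleFunc.tendsto_approxOn measurable_id (mem_univ _) (by simp)
  let ν : ℕ → ProbabilityMeasure S := fun n => μ.map (f n).measurable.aemeasurable
  have hlim : Tendsto ν atTop (𝓝 μ) := by
    rw [ProbabilityMeasure.tendsto_iff_forall_integral_tendsto]
    intro g
    have h : ∀ n, ∫ x, g x ∂(ν n : Measure S) = ∫ x, g (f n x) ∂(μ : Measure S) := fun n =>
      integral_map (f n).measurable.aemeasurable g.continuous.aestronglyMeasurable
    simp only [h]
    refine tendsto_integral_of_dominated_convergence (fun _ => ‖g‖)
      (fun n => (g.continuous.measurable.comp (f n).measurable).aestronglyMeasurable)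
      (integrable_const _) (fun n => Eventually.of_forall fun x => g.norm_coe_le_norm _)
      (Eventually.of_forall fun x => (g.continuous.tendsto x).comp (hf x))
  have hν : ∀ n, U (ν n) = ∫ x, U (diracProba x) ∂(ν n : Measure S) := fun n => by
    refine affine_eq_integral_of_finite_support hU (f n).range (ν n) ?_
    change Measure.map (f n) (μ : Measure S) _ = 0
    rw [Measure.map_apply (f n).measurable (f n).range.measurableSet.compl]
    convert measure_empty (μ := (μ : Measure S))
    ext x
    simp
  let u : BoundedContinuousFunction S ℝ :=
    BoundedContinuousFunction.ofNormedAddCommGroup (fun x => U (diracProba x))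
      (hc.comp continuous_diracProba) C fun x => hb _
  have h1 : Tendsto (fun n => U (ν n)) atTop (𝓝 (U μ)) := (hc.tendsto μ).comp hlim
  have h2 := ProbabilityMeasure.tendsto_iff_forall_integral_tendsto.1 hlim u
  simp only [hν] at h1
  exact tendsto_nhds_unique h1 h2

end Integral

/-- von Neumann–Morgenstern expected utility theorem: a continuous total preorder on the
space of Borel probability measures on a Polish space (with the topology of weak
convergence) satisfying the independence axiom is represented by the expectation of a
bounded continuous utility function. -/
theorem exists_expected_utility_representation
    {S : Type*} [MeasurableSpace S] [TopologicalSpace S] [PolishSpace S] [BorelSpace S]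
    (pref : ProbabilityMeasure S → ProbabilityMeasure S → Prop)
    (hrefl : ∀ μ, pref μ μ)
    (htrans : ∀ μ ν ξ, pref μ ν → pref ν ξ → pref μ ξ)
    (htotal : ∀ μ ν, pref μ ν ∨ pref ν μ)
    (hcont : ∀ μ : ProbabilityMeasure S,
      IsClosed {ν | pref μ ν} ∧ IsClosed {ν | pref ν μ})
    (hind : ∀ μ ν ξ : ProbabilityMeasure S, StrictPref pref μ ν →
      ∀ (α : ℝ) (hα0 : 0 < α) (hα1 : α < 1),
        StrictPref pref (pmix α hα0.le hα1.le μ ξ) (pmix α hα0.le hα1.le ν ξ)) :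
    ∃ u : S → ℝ, Continuous u ∧ (∃ C : ℝ, ∀ z, |u z| ≤ C) ∧
      ∀ μ ν : ProbabilityMeasure S,
        StrictPref pref μ ν ↔ ∫ z, u z ∂(μ : Measure S) > ∫ z, u z ∂(ν : Measure S) := by
  have H : IsContinuousIndependent pref :=
    ⟨htrans _ _ _, htotal, fun μ => (hcont μ).1, fun μ => (hcont μ).2,
      fun {μ ν} ξ h => hind μ ν ξ h⟩
  obtain ⟨U, hc, hb, hU, hrep⟩ := H.exists_affine_representation
  refine ⟨fun x => U (diracProba x), hc.comp continuous_diracProba, ⟨1, fun z => hb _⟩,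
    fun μ ν => ?_⟩
  rw [← affine_eq_integral hc hb hU μ, ← affine_eq_integral hc hb hU ν, StrictPref, hrep, hrep,
    not_le, gt_iff_lt]
  exact ⟨And.right, fun h => ⟨h.le, h⟩⟩
end

section
/- Let Q be the set of all nondecreasing, left-continuous real functions on (0,1), and lin(Q) = Q − Q its linear span in the space of measurable functions on (0,1). If a total preorder ⪯ on Q satisfies the dual independence axiom and the dual Archimedean axiom, then there exists a linear functional U on lin(Q) whose restriction to Q is a numerical representation of ⪯, i.e., for Φ, Ψ ∈ Q, Φ ≻ Ψ if and only if U(Φ) > U(Ψ). -/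
/-- The prospect space `Q` of quantile functions: nondecreasing, left-continuous real
functions on the interval `(0,1)`. -/
def QSet : Set (ℝ → ℝ) :=
  {Φ | MonotoneOn Φ (Set.Ioo 0 1) ∧
    ∀ p ∈ Set.Ioo (0:ℝ) 1, ContinuousWithinAt Φ (Set.Iio p) p}

/-- A strict weak order `R` on a convex set `Q` satisfying the independence and Archimedean
axioms of expected utility theory. -/
structure IsMixturePreference {E : Type*} [AddCommGroup E] [Module ℝ E]
    (Q : Set E) (R : E → E → Prop) : Prop where
  convex : Convex ℝ Q
  irrefl : ∀ a ∈ Q, ¬ R a a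
  trans : ∀ a ∈ Q, ∀ b ∈ Q, ∀ c ∈ Q, R a b → R b c → R a c
  cotrans : ∀ a ∈ Q, ∀ b ∈ Q, ∀ c ∈ Q, R a b → R a c ∨ R c b
  independence : ∀ a ∈ Q, ∀ b ∈ Q, ∀ c ∈ Q, R a b → ∀ α ∈ Set.Ioo (0 : ℝ) 1,
    R (α • a + (1 - α) • c) (α • b + (1 - α) • c)
  archimedean : ∀ a ∈ Q, ∀ b ∈ Q, ∀ c ∈ Q, R a b → R b c →
    ∃ α ∈ Set.Ioo (0 : ℝ) 1, ∃ β ∈ Set.Ioo (0 : ℝ) 1,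
      R (α • a + (1 - α) • c) b ∧ R b (β • a + (1 - β) • c)

namespace IsMixturePreference

variable {E : Type*} [AddCommGroup E] [Module ℝ E] {Q : Set E} {R : E → E → Prop}

lemma one_sub_mem {α : ℝ} (h : α ∈ Set.Ioo (0 : ℝ) 1) : 1 - α ∈ Set.Ioo (0 : ℝ) 1 :=
  ⟨by linarith [h.2], by linarith [h.1]⟩

lemma mix_mem (h : IsMixturePreference Q R) {a b : E} (ha : a ∈ Q) (hb : b ∈ Q) {α : ℝ}
    (hα : α ∈ Set.Ioo (0 : ℝ) 1) : α • a + (1 - α) • b ∈ Q :=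
  h.convex ha hb hα.1.le (one_sub_mem hα).1.le (add_sub_cancel _ _)

lemma mix_swap (a b : E) (α : ℝ) :
    (1 - α) • a + (1 - (1 - α)) • b = α • b + (1 - α) • a := by
  module

/-- The axioms are invariant under reversing the preference. -/
lemma swap (h : IsMixturePreference Q R) : IsMixturePreference Q (fun a b => R b a) where
  convex := h.convex
  irrefl := h.irrefl
  trans a ha b hb c hc hab hbc := h.trans c hc b hb a ha hbc hab
  cotrans a ha b hb c hc hab := (h.cotrans b hb a ha c hc hab).symm
  independence a ha b hb := h.independence b hb a ha
  archimedean a ha b hb c hc hab hbc := by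
    obtain ⟨α, hα, β, hβ, h1, h2⟩ := h.archimedean c hc b hb a ha hbc hab
    refine ⟨1 - β, one_sub_mem hβ, 1 - α, one_sub_mem hα, ?_, ?_⟩
    · rwa [mix_swap]
    · rwa [mix_swap]

lemma mix_lt (h : IsMixturePreference Q R) {a b : E} (ha : a ∈ Q) (hb : b ∈ Q) (hab : R a b)
    {α : ℝ} (hα : α ∈ Set.Ioo (0 : ℝ) 1) : R (α • a + (1 - α) • b) b := by
  have := h.independence a ha b hb b hb hab α hα
  rwa [show α • b + (1 - α) • b = b by module] at this

lemma lt_mix (h : IsMixturePreference Q R) {a b : E} (ha : a ∈ Q) (hb : b ∈ Q) (hab : R a b)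
    {α : ℝ} (hα : α ∈ Set.Ioo (0 : ℝ) 1) : R a (α • a + (1 - α) • b) := by
  have := h.swap.mix_lt hb ha hab (one_sub_mem hα)
  rwa [mix_swap] at this

/-- The convex cone generated by the differences `a - b` with `a` strictly preferred to `b`. -/
def positiveCone (h : IsMixturePreference Q R) : ConvexCone ℝ E where
  carrier := {x | ∃ c : ℝ, 0 < c ∧ ∃ a ∈ Q, ∃ b ∈ Q, R a b ∧ x = c • (a - b)}
  smul_mem' := by
    rintro k hk _ ⟨c, hc, a, ha, b, hb, hab, rfl⟩
    exact ⟨k * c, mul_pos hk hc, a, ha, b, hb, hab, by module⟩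
  add_mem' := by
    rintro _ ⟨c, hc, a, ha, b, hb, hab, rfl⟩ _ ⟨d, hd, a', ha', b', hb', hab', rfl⟩
    have hs : 0 < c + d := add_pos hc hd
    set α := c / (c + d) with hα_def
    have hα : α ∈ Set.Ioo (0 : ℝ) 1 :=
      ⟨div_pos hc hs, (div_lt_one hs).2 (by linarith)⟩
    have h1 := h.independence a ha b hb a' ha' hab α hα
    have h2 := h.independence a' ha' b' hb' b hb hab' (1 - α) (one_sub_mem hα)
    rw [mix_swap, mix_swap] at h2
    refine ⟨c + d, hs, _, h.mix_mem ha ha' hα, _, h.mix_mem hb hb' hα,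
      h.trans _ (h.mix_mem ha ha' hα) _ (h.mix_mem hb ha' hα) _ (h.mix_mem hb hb' hα) h1 h2, ?_⟩
    have hc' : c = (c + d) * α := by rw [hα_def]; field_simp
    have hd' : d = (c + d) * (1 - α) := by linarith
    calc c • (a - b) + d • (a' - b')
        = ((c + d) * α) • (a - b) + ((c + d) * (1 - α)) • (a' - b') := by rw [← hc', ← hd']
      _ = _ := by module

lemma sub_mem_positiveCone (h : IsMixturePreference Q R) {a b : E} (ha : a ∈ Q) (hb : b ∈ Q)
    (hab : R a b) : a - b ∈ h.positiveCone :=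
  ⟨1, one_pos, a, ha, b, hb, hab, by module⟩

/-- The positive cone with the origin adjoined. -/
def pointedPositiveCone (h : IsMixturePreference Q R) : PointedCone ℝ E where
  carrier := {x | x = 0 ∨ x ∈ h.positiveCone}
  zero_mem' := Or.inl rfl
  add_mem' := by
    rintro x y (rfl | hx) (rfl | hy)
    · exact Or.inl (add_zero 0)
    · exact Or.inr (by rwa [zero_add])
    · exact Or.inr (by rwa [add_zero])
    · exact Or.inr (h.positiveCone.add_mem hx hy)
  smul_mem' := by
    rintro ⟨c, hc⟩ x (rfl | hx)
    · exact Or.inl (smul_zero _)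
    · rcases hc.lt_or_eq with hc | rfl
      · exact Or.inr (h.positiveCone.smul_mem hc hx)
      · exact Or.inl (zero_smul ℝ x)

lemma zero_notMem_positiveCone (h : IsMixturePreference Q R) : (0 : E) ∉ h.positiveCone := by
  rintro ⟨c, hc, a, ha, b, hb, hab, h0⟩
  obtain rfl : a = b := sub_eq_zero.1 ((smul_eq_zero.1 h0.symm).resolve_left hc.ne')
  exact h.irrefl a ha hab

lemma neg_mem_positiveCone_swap (h : IsMixturePreference Q R) {x : E}
    (hx : x ∈ h.swap.positiveCone) : -x ∈ h.positiveCone := by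
  obtain ⟨c, hc, a, ha, b, hb, hab, rfl⟩ := hx
  exact ⟨c, hc, b, hb, a, ha, hab, by module⟩

/-- Every alternative can be moved above the midpoint of `a` and `b` by adding a multiple of
`a - b`. -/
lemma exists_smul_add_sub_mid_mem (h : IsMixturePreference Q R) {a b x : E} (ha : a ∈ Q)
    (hb : b ∈ Q) (hab : R a b) (hx : x ∈ Q) :
    ∃ t : ℝ, t • (a - b) + (x - ((1 / 2 : ℝ) • a + (1 / 2 : ℝ) • b)) ∈ h.positiveCone := by
  have half : (1 / 2 : ℝ) ∈ Set.Ioo (0 : ℝ) 1 := by norm_num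
  rw [show (1 / 2 : ℝ) • a + (1 / 2 : ℝ) • b = (1 / 2 : ℝ) • a + (1 - 1 / 2 : ℝ) • b by norm_num]
  set m := (1 / 2 : ℝ) • a + (1 - 1 / 2 : ℝ) • b with hm_def
  have hm : m ∈ Q := h.mix_mem ha hb half
  have ham : R a m := h.lt_mix ha hb hab half
  have hn := h.mix_mem ha hm half
  have han := h.lt_mix ha hm ham half
  have hnm := h.mix_lt ha hm ham half
  have key : ∃ α ∈ Set.Ioo (0 : ℝ) 1, R (α • a + (1 - α) • x) m := by
    rcases h.cotrans _ hn _ hm x hx hnm with hnx | hxm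
    · obtain ⟨α, hα, -, -, hα', -⟩ := h.archimedean _ ha _ hn _ hx han hnx
      exact ⟨α, hα, h.trans _ (h.mix_mem ha hx hα) _ hn _ hm hα' hnm⟩
    · refine ⟨1 / 2, half, ?_⟩
      have h1 := h.independence a ha m hm x hx ham _ half
      have h3 := h.mix_lt hx hm hxm half
      rw [← mix_swap, sub_sub_cancel, show (1 - 1 / 2 : ℝ) = 1 / 2 by norm_num] at h3
      rw [show (1 - 1 / 2 : ℝ) = 1 / 2 by norm_num] at h1 ⊢
      have hmem : ∀ u ∈ Q, (1 / 2 : ℝ) • u + (1 / 2 : ℝ) • x ∈ Q := fun u hu =>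
        h.convex hu hx half.1.le half.1.le (by norm_num)
      exact h.trans _ (hmem a ha) _ (hmem m hm) _ hm h1 h3
  obtain ⟨α, hα, hαm⟩ := key
  have hα1 : (0 : ℝ) < 1 - α := (one_sub_mem hα).1
  refine ⟨(1 - α)⁻¹ * (α / 2), (1 - α)⁻¹, inv_pos.2 hα1, _, h.mix_mem ha hx hα, m, hm, hαm, ?_⟩
  have : x - m = (1 - α)⁻¹ • ((1 - α) • (x - m)) := by
    rw [smul_smul, inv_mul_cancel₀ hα1.ne', one_smul]
  rw [this, hm_def]
  module

lemma exists_smul_add_mem (h : IsMixturePreference Q R)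
    (hdiff : ∀ y : E, ∃ x ∈ Q, ∃ z ∈ Q, y = x - z) {a b : E} (ha : a ∈ Q) (hb : b ∈ Q)
    (hab : R a b) (y : E) : ∃ t : ℝ, t • (a - b) + y ∈ h.positiveCone := by
  obtain ⟨x, hx, z, hz, rfl⟩ := hdiff y
  obtain ⟨t, ht⟩ := h.exists_smul_add_sub_mid_mem ha hb hab hx
  obtain ⟨s, hs⟩ := h.swap.exists_smul_add_sub_mid_mem hb ha hab hz
  refine ⟨t + s, ?_⟩
  convert h.positiveCone.add_mem ht (h.neg_mem_positiveCone_swap hs) using 1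
  module

lemma exists_linearMap_pos (h : IsMixturePreference Q R)
    (hdiff : ∀ y : E, ∃ x ∈ Q, ∃ z ∈ Q, y = x - z) {a b : E} (ha : a ∈ Q) (hb : b ∈ Q)
    (hab : R a b) : ∃ g : E →ₗ[ℝ] ℝ, ∀ x ∈ Q, ∀ y ∈ Q, R x y → g y < g x := by
  set e := a - b
  have he : e ∈ h.positiveCone := h.sub_mem_positiveCone ha hb hab
  have he0 : e ≠ 0 := fun h0 => h.zero_notMem_positiveCone (h0 ▸ he)
  let f : E →ₗ.[ℝ] ℝ := LinearPMap.mkSpanSingleton e 1 he0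
  have hf : ∀ t : ℝ, ∀ ht : t • e ∈ f.domain, f ⟨t • e, ht⟩ = t := fun t ht =>
    (LinearPMap.mkSpanSingleton'_apply e (1 : ℝ) _ t ht).trans (mul_one t)
  have hdom : ∀ t : ℝ, t • e ∈ f.domain := fun t => Submodule.mem_span_singleton.2 ⟨t, rfl⟩
  obtain ⟨g, hg, hpos⟩ := riesz_extension h.pointedPositiveCone f (by
    rintro ⟨x, hx⟩ hxP
    obtain ⟨t, rfl⟩ := Submodule.mem_span_singleton.1 hx
    rw [hf]
    rcases hxP with h0 | hxP
    · exact ((smul_eq_zero.1 h0).resolve_right he0).ge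
    by_contra! ht
    apply h.zero_notMem_positiveCone
    convert h.positiveCone.add_mem hxP (h.positiveCone.smul_mem (neg_pos.2 ht) he) using 1
    module) (by
    intro y
    obtain ⟨t, ht⟩ := h.exists_smul_add_mem hdiff ha hb hab y
    exact ⟨⟨t • e, hdom t⟩, Or.inr ht⟩)
  have hge : g e = 1 := by
    have : g ((1 : ℝ) • e) = 1 := (hg ⟨(1 : ℝ) • e, hdom 1⟩).trans (hf 1 _)
    rwa [one_smul] at this
  refine ⟨g, fun x hx y hy hxy => ?_⟩
  have h0 := hpos _ (Or.inr (h.sub_mem_positiveCone hx hy hxy))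
  obtain ⟨t, ht⟩ := h.exists_smul_add_mem hdiff hx hy hxy (-e)
  have h1 := hpos _ (Or.inr ht)
  rw [map_add, map_smul, map_neg, hge, smul_eq_mul] at h1
  rw [map_sub] at h0
  rcases h0.lt_or_eq with h2 | h2
  · linarith
  · rw [map_sub, ← h2] at h1
    linarith

lemma nonpos_of_forall_le_mul {d k : ℝ} (h : ∀ β ∈ Set.Ioo (0 : ℝ) 1, d ≤ β * k) : d ≤ 0 := by
  have hlim : Filter.Tendsto (fun β : ℝ => β * k) (nhdsWithin 0 (Set.Ioi 0)) (nhds 0) := by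
    have : Continuous fun β : ℝ => β * k := by fun_prop
    simpa using (this.tendsto 0).mono_left nhdsWithin_le_nhds
  refine ge_of_tendsto hlim ?_
  filter_upwards [Ioo_mem_nhdsGT (zero_lt_one' ℝ)] with β hβ using h β hβ

lemma not_lt_of_indifferent (h : IsMixturePreference Q R) {g : E →ₗ[ℝ] ℝ}
    (hg : ∀ x ∈ Q, ∀ y ∈ Q, R x y → g y < g x) {x y z : E} (hx : x ∈ Q) (hy : y ∈ Q)
    (hz : z ∈ Q) (hyx : ¬ R x y) (hzy : R z y) : ¬ g y < g x := by
  suffices g x - g y ≤ 0 by linarith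
  refine nonpos_of_forall_le_mul (k := g z - g y) fun β hβ => ?_
  have hm := h.mix_mem hz hy hβ
  have := hg _ hm _ hx
    ((h.cotrans _ hm y hy x hx (h.mix_lt hz hy hzy hβ)).resolve_right hyx)
  simp only [map_add, map_smul, smul_eq_mul] at this
  linarith

/-- The mixture space theorem, on a convex set whose differences exhaust the space. -/
theorem exists_linearMap_representation (h : IsMixturePreference Q R)
    (hdiff : ∀ y : E, ∃ x ∈ Q, ∃ z ∈ Q, y = x - z) :
    ∃ g : E →ₗ[ℝ] ℝ, ∀ x ∈ Q, ∀ y ∈ Q, R x y ↔ g y < g x := by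
  by_cases hR : ∃ a ∈ Q, ∃ b ∈ Q, R a b
  · obtain ⟨a, ha, b, hb, hab⟩ := hR
    obtain ⟨g, hg⟩ := h.exists_linearMap_pos hdiff ha hb hab
    refine ⟨g, fun x hx y hy => ⟨hg x hx y hy, fun hlt => ?_⟩⟩
    by_contra hxy
    rcases h.cotrans a ha b hb y hy hab with hay | hyb
    · exact h.not_lt_of_indifferent hg hx hy ha hxy hay hlt
    · rcases h.cotrans y hy b hb x hx hyb with hyx | hxb
      · exact hlt.not_gt (hg y hy x hx hyx)
      · refine h.swap.not_lt_of_indifferent (g := -g) (x := y) (y := x) (z := b)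
          (fun u hu v hv huv => ?_) hy hx hb hxy hxb ?_
        · simpa using hg v hv u hu huv
        · simpa using hlt
  · push Not at hR
    exact ⟨0, fun x hx y hy => by simpa using hR x hx y hy⟩

end IsMixturePreference

lemma add_mem_QSet {Φ Ψ : ℝ → ℝ} (hΦ : Φ ∈ QSet) (hΨ : Ψ ∈ QSet) : Φ + Ψ ∈ QSet :=
  ⟨hΦ.1.add hΨ.1, fun p hp => (hΦ.2 p hp).add (hΨ.2 p hp)⟩

lemma smul_mem_QSet {Φ : ℝ → ℝ} (hΦ : Φ ∈ QSet) {c : ℝ} (hc : 0 ≤ c) : c • Φ ∈ QSet :=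
  ⟨fun _ hp _ hq hpq => mul_le_mul_of_nonneg_left (hΦ.1 hp hq hpq) hc,
    fun p hp => (hΦ.2 p hp).const_smul c⟩

lemma convex_QSet : Convex ℝ QSet := fun _ hΦ _ hΨ _ _ ha hb _ =>
  add_mem_QSet (smul_mem_QSet hΦ ha) (smul_mem_QSet hΨ hb)

lemma zero_mem_QSet : (0 : ℝ → ℝ) ∈ QSet :=
  ⟨fun _ _ _ _ _ => le_rfl, fun _ _ => continuousWithinAt_const⟩

lemma exists_sub_of_mem_span_QSet {y : ℝ → ℝ} (hy : y ∈ Submodule.span ℝ QSet) :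
    ∃ Φ ∈ QSet, ∃ Ψ ∈ QSet, y = Φ - Ψ := by
  induction hy using Submodule.span_induction with
  | mem x hx => exact ⟨x, hx, 0, zero_mem_QSet, by simp⟩
  | zero => exact ⟨0, zero_mem_QSet, 0, zero_mem_QSet, by simp⟩
  | add x y _ _ hx hy =>
    obtain ⟨a, ha, b, hb, rfl⟩ := hx
    obtain ⟨c, hc, d, hd, rfl⟩ := hy
    exact ⟨a + c, add_mem_QSet ha hc, b + d, add_mem_QSet hb hd, by module⟩
  | smul t x _ hx =>
    obtain ⟨a, ha, b, hb, rfl⟩ := hx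
    rcases le_total 0 t with ht | ht
    · exact ⟨t • a, smul_mem_QSet ha ht, t • b, smul_mem_QSet hb ht, by module⟩
    · have ht' : 0 ≤ -t := neg_nonneg.2 ht
      exact ⟨-t • b, smul_mem_QSet hb ht', -t • a, smul_mem_QSet ha ht', by module⟩

/-- Affine numerical representation of dual preferences: a total preorder on `Q`
satisfying the dual independence and dual Archimedean axioms admits a linear functional
on `lin(Q)` (the linear span of `Q`) whose restriction to `Q` is a numerical
representation. -/
theorem exists_dual_affine_numerical_representation
    (pref : (ℝ → ℝ) → (ℝ → ℝ) → Prop)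
    (hrefl : ∀ Φ ∈ QSet, pref Φ Φ)
    (htrans : ∀ Φ Ψ Υ, Φ ∈ QSet → Ψ ∈ QSet → Υ ∈ QSet →
      pref Φ Ψ → pref Ψ Υ → pref Φ Υ)
    (htotal : ∀ Φ Ψ, Φ ∈ QSet → Ψ ∈ QSet → pref Φ Ψ ∨ pref Ψ Φ)
    (hind : ∀ Φ Ψ Υ, Φ ∈ QSet → Ψ ∈ QSet → Υ ∈ QSet → StrictPref pref Φ Ψ →
      ∀ α ∈ Set.Ioo (0:ℝ) 1,
        StrictPref pref (fun p => α * Φ p + (1 - α) * Υ p)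
          (fun p => α * Ψ p + (1 - α) * Υ p))
    (harch : ∀ Φ Ψ Υ, Φ ∈ QSet → Ψ ∈ QSet → Υ ∈ QSet →
      StrictPref pref Φ Ψ → StrictPref pref Ψ Υ →
      ∃ α ∈ Set.Ioo (0:ℝ) 1, ∃ β ∈ Set.Ioo (0:ℝ) 1,
        StrictPref pref (fun p => α * Φ p + (1 - α) * Υ p) Ψ ∧
        StrictPref pref Ψ (fun p => β * Φ p + (1 - β) * Υ p)) :
    ∃ U : (Submodule.span ℝ QSet : Submodule ℝ (ℝ → ℝ)) →ₗ[ℝ] ℝ,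
      ∀ Φ Ψ, ∀ (hΦ : Φ ∈ QSet) (hΨ : Ψ ∈ QSet),
        StrictPref pref Φ Ψ ↔
          U ⟨Φ, Submodule.subset_span hΦ⟩ > U ⟨Ψ, Submodule.subset_span hΨ⟩ := by
  have h : IsMixturePreference
      {x : (Submodule.span ℝ QSet : Submodule ℝ (ℝ → ℝ)) | (x : ℝ → ℝ) ∈ QSet}
      (fun x y => StrictPref pref (x : ℝ → ℝ) y) :=
    { convex := fun x hx y hy a b ha hb hab => convex_QSet hx hy ha hb hab
      irrefl := fun a _ haa => haa.2 haa.1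
      trans := fun a ha b hb c hc hab hbc =>
        ⟨htrans _ _ _ ha hb hc hab.1 hbc.1,
          fun hca => hab.2 (htrans _ _ _ hb hc ha hbc.1 hca)⟩
      cotrans := fun a ha b hb c hc hab => by
        by_cases hca : pref c a
        · exact Or.inr ⟨htrans _ _ _ hc ha hb hca hab.1,
            fun hbc => hab.2 (htrans _ _ _ hb hc ha hbc hca)⟩
        · exact Or.inl ⟨(htotal _ _ ha hc).resolve_right hca, hca⟩
      independence := fun a ha b hb c hc => hind _ _ _ ha hb hc
      archimedean := fun a ha b hb c hc => harch _ _ _ ha hb hc }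
  obtain ⟨g, hg⟩ := h.exists_linearMap_representation fun y => by
    obtain ⟨Φ, hΦ, Ψ, hΨ, hy⟩ := exists_sub_of_mem_span_QSet y.2
    exact ⟨⟨Φ, Submodule.subset_span hΦ⟩, hΦ, ⟨Ψ, Submodule.subset_span hΨ⟩, hΨ, Subtype.ext hy⟩
  exact ⟨g, fun Φ Ψ hΦ hΨ => hg ⟨Φ, _⟩ hΦ ⟨Ψ, _⟩ hΨ⟩
end

section
/- Let Σ be the algebra of subsets of (0,1] generated by half-open intervals (a,b] with 0 < a < b ≤ 1, and let B((0,1],Σ) be the Banach space (with supremum norm) of bounded functions on (0,1] that are uniform limits of Σ-simple functions. Let Q_b ⊂ B((0,1],Σ) be the set of bounded, nondecreasing, left-continuous functions on (0,1]. If a total preorder ⪯ on Q_b is continuous (with respect to the supremum norm), monotonic (Φ(p) ≥ Ψ(p) for all p implies Φ ⪰ Ψ), and satisfies the dual independence axiom, then there exists a continuous linear functional on B((0,1],Σ) whose restriction to Q_b is a numerical representation of ⪯. -/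
open scoped BigOperators

/-- The algebra `Σ` of subsets of `(0,1]` generated by the half-open intervals `(a,b]`:
its elements are the finite unions of such intervals. -/
def SigmaAlg : Set (Set ℝ) :=
  {A | ∃ s : Finset (ℝ × ℝ), (∀ q ∈ s, 0 ≤ q.1 ∧ q.2 ≤ 1) ∧
    A = ⋃ q ∈ s, Set.Ioc q.1 q.2}

/-- A `Σ`-simple function on `(0,1]`: a finite linear combination of indicator functions
of disjoint sets in `Σ`. -/
def IsSimpleFn (f : ℝ → ℝ) : Prop :=
  ∃ (n : ℕ) (c : Fin n → ℝ) (A : Fin n → Set ℝ),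
    (∀ i, A i ∈ SigmaAlg) ∧ (∀ i j, i ≠ j → Disjoint (A i) (A j)) ∧
    ∀ p ∈ Set.Ioc (0:ℝ) 1, f p = ∑ i, Set.indicator (A i) (fun _ => c i) p

/-- Uniform convergence on `(0,1]`. -/
def UnifTendsto (fs : ℕ → ℝ → ℝ) (f : ℝ → ℝ) : Prop :=
  ∀ ε > (0:ℝ), ∃ N, ∀ n ≥ N, ∀ p ∈ Set.Ioc (0:ℝ) 1, |fs n p - f p| ≤ ε

/-- The space `B((0,1],Σ)` of bounded functions on `(0,1]` that are uniform limits of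
`Σ`-simple functions. -/
def BSpace : Set (ℝ → ℝ) :=
  {f | ∃ g : ℕ → ℝ → ℝ, (∀ n, IsSimpleFn (g n)) ∧ UnifTendsto g f}

/-- The supremum norm over `(0,1]`. -/
noncomputable def supAbs (f : ℝ → ℝ) : ℝ :=
  ⨆ p : Set.Ioc (0:ℝ) 1, |f p.1|

/-- The prospect space `Q_b` of bounded, nondecreasing, left-continuous functions
on `(0,1]`. -/
def Qb : Set (ℝ → ℝ) :=
  {Φ | (∃ C : ℝ, ∀ p ∈ Set.Ioc (0:ℝ) 1, |Φ p| ≤ C) ∧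
    MonotoneOn Φ (Set.Ioc 0 1) ∧
    ∀ p ∈ Set.Ioc (0:ℝ) 1, ContinuousWithinAt Φ (Set.Iio p) p}

/-- The preference hypotheses: a total preorder on `Qb` that is monotonic, continuous in the
supremum norm, and satisfies the dual independence axiom. -/
structure IsDualPref (pref : (ℝ → ℝ) → (ℝ → ℝ) → Prop) : Prop where
  trans : ∀ Φ Ψ Υ, Φ ∈ Qb → Ψ ∈ Qb → Υ ∈ Qb → pref Φ Ψ → pref Ψ Υ → pref Φ Υ
  total : ∀ Φ Ψ, Φ ∈ Qb → Ψ ∈ Qb → pref Φ Ψ ∨ pref Ψ Φ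
  mono : ∀ Φ Ψ, Φ ∈ Qb → Ψ ∈ Qb → (∀ p ∈ Set.Ioc (0:ℝ) 1, Ψ p ≤ Φ p) → pref Φ Ψ
  cont : ∀ Φ ∈ Qb, ∀ (Ψs : ℕ → ℝ → ℝ) (Ψ : ℝ → ℝ), (∀ n, Ψs n ∈ Qb) → Ψ ∈ Qb →
    UnifTendsto Ψs Ψ →
    ((∀ n, pref Φ (Ψs n)) → pref Φ Ψ) ∧ ((∀ n, pref (Ψs n) Φ) → pref Ψ Φ)
  indep : ∀ Φ Ψ Υ, Φ ∈ Qb → Ψ ∈ Qb → Υ ∈ Qb → StrictPref pref Φ Ψ →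
    ∀ α ∈ Set.Ioo (0:ℝ) 1,
      StrictPref pref (fun p => α * Φ p + (1 - α) * Υ p)
        (fun p => α * Ψ p + (1 - α) * Υ p)

lemma const_mem_Qb (c : ℝ) : (fun _ : ℝ => c) ∈ Qb :=
  ⟨⟨|c|, fun _ _ => le_rfl⟩, fun _ _ _ _ _ => le_rfl, fun _ _ => continuousWithinAt_const⟩

lemma combination_mem_Qb {Φ Ψ : ℝ → ℝ} (hΦ : Φ ∈ Qb) (hΨ : Ψ ∈ Qb) {a b : ℝ}
    (ha : 0 ≤ a) (hb : 0 ≤ b) : (fun p => a * Φ p + b * Ψ p) ∈ Qb := by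
  obtain ⟨⟨C, hC⟩, hΦm, hΦc⟩ := hΦ
  obtain ⟨⟨D, hD⟩, hΨm, hΨc⟩ := hΨ
  refine ⟨⟨a * C + b * D, fun p hp => ?_⟩, fun p hp q hq hpq => ?_, fun p hp => ?_⟩
  · calc |a * Φ p + b * Ψ p| ≤ |a * Φ p| + |b * Ψ p| := abs_add_le _ _
      _ = a * |Φ p| + b * |Ψ p| := by rw [abs_mul, abs_mul, abs_of_nonneg ha, abs_of_nonneg hb]
      _ ≤ a * C + b * D := by gcongr; exacts [hC p hp, hD p hp]
  · exact add_le_add (mul_le_mul_of_nonneg_left (hΦm hp hq hpq) ha)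
      (mul_le_mul_of_nonneg_left (hΨm hp hq hpq) hb)
  · exact (continuousWithinAt_const.mul (hΦc p hp)).add (continuousWithinAt_const.mul (hΨc p hp))

lemma add_mem_Qb {Φ Ψ : ℝ → ℝ} (hΦ : Φ ∈ Qb) (hΨ : Ψ ∈ Qb) : (fun p => Φ p + Ψ p) ∈ Qb := by
  simpa using combination_mem_Qb hΦ hΨ zero_le_one zero_le_one

lemma const_mul_mem_Qb {Φ : ℝ → ℝ} (hΦ : Φ ∈ Qb) {a : ℝ} (ha : 0 ≤ a) :
    (fun p => a * Φ p) ∈ Qb := by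
  simpa using combination_mem_Qb hΦ (const_mem_Qb 0) ha zero_le_one

lemma add_const_mem_Qb {Φ : ℝ → ℝ} (hΦ : Φ ∈ Qb) (c : ℝ) : (fun p => Φ p + c) ∈ Qb :=
  add_mem_Qb hΦ (const_mem_Qb c)

/-- The sequence `Φ + a / (n + 1)` converges uniformly to `Φ`. -/
lemma unifTendsto_add_div (Φ : ℝ → ℝ) (a : ℝ) :
    UnifTendsto (fun n p => Φ p + a * (1 / ((n : ℝ) + 1))) Φ := by
  intro ε hε
  have h : Filter.Tendsto (fun n : ℕ => a * (1 / ((n : ℝ) + 1))) Filter.atTop (nhds 0) := by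
    simpa using tendsto_one_div_add_atTop_nhds_zero_nat.const_mul a
  obtain ⟨N, hN⟩ := Metric.tendsto_atTop.1 h ε hε
  refine ⟨N, fun n hn p _ => ?_⟩
  have := hN n hn
  rw [Real.dist_eq, sub_zero] at this
  simpa using this.le

namespace IsDualPref

variable {pref : (ℝ → ℝ) → (ℝ → ℝ) → Prop}

/-- Unless the preference is trivial, adding a positive constant is a strict improvement. -/
lemma strictPref_add_const (h : IsDualPref pref) {Φ₀ Ψ₀ : ℝ → ℝ} (hΦ₀ : Φ₀ ∈ Qb) (hΨ₀ : Ψ₀ ∈ Qb)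
    (h₀ : StrictPref pref Φ₀ Ψ₀) {Φ : ℝ → ℝ} (hΦ : Φ ∈ Qb) {ε : ℝ} (hε : 0 < ε) :
    StrictPref pref (fun p => Φ p + ε) Φ := by
  obtain ⟨d, hd⟩ := hΦ₀.1
  obtain ⟨c', hc'⟩ := hΨ₀.1
  obtain ⟨c, rfl⟩ : ∃ c, c' = -c := ⟨-c', by ring⟩
  have qc := const_mem_Qb c
  have qd := const_mem_Qb d
  have hdΦ : pref (fun _ => d) Φ₀ := h.mono _ _ qd hΦ₀ fun p hp => (abs_le.1 (hd p hp)).2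
  have hΨc : pref Ψ₀ (fun _ => c) := h.mono _ _ hΨ₀ qc fun p hp => by
    linarith [(abs_le.1 (hc' p hp)).1]
  have hnot : ¬ pref (fun _ => c) (fun _ => d) := fun hcd =>
    h₀.2 (h.trans _ _ _ hΨ₀ qc hΦ₀ hΨc (h.trans _ _ _ qc qd hΦ₀ hcd hdΦ))
  have hs : StrictPref pref (fun _ => d) (fun _ => c) :=
    ⟨(h.total _ _ qd qc).resolve_right hnot, hnot⟩
  have hlt : c < d := by
    by_contra! hle
    exact hnot (h.mono _ _ qc qd fun _ _ => hle)
  have hdc : 0 < d - c := sub_pos.2 hlt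
  obtain ⟨α, hα0, hα1, hαε⟩ : ∃ α : ℝ, 0 < α ∧ α < 1 ∧ α * (d - c) ≤ ε := by
    refine ⟨min (1 / 2) (ε / (d - c)), by positivity, ?_, ?_⟩
    · exact (min_le_left _ _).trans_lt (by norm_num)
    · exact (le_div_iff₀ hdc).1 (min_le_right _ _)
  have h1α : 0 < 1 - α := sub_pos.2 hα1
  have qΥ : (fun p => (1 - α)⁻¹ * Φ p + -(α * c) / (1 - α)) ∈ Qb :=
    add_const_mem_Qb (const_mul_mem_Qb hΦ (inv_nonneg.2 h1α.le)) _
  have key := h.indep _ _ _ qd qc qΥ hs α ⟨hα0, hα1⟩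
  have e1 : (fun p => α * d + (1 - α) * ((1 - α)⁻¹ * Φ p + -(α * c) / (1 - α))) =
      fun p => Φ p + α * (d - c) := by
    funext p; field_simp; ring
  have e2 : (fun p => α * c + (1 - α) * ((1 - α)⁻¹ * Φ p + -(α * c) / (1 - α))) = Φ := by
    funext p; field_simp; ring
  rw [e1, e2] at key
  have q1 := add_const_mem_Qb hΦ (α * (d - c))
  have q2 := add_const_mem_Qb hΦ ε
  have hle : pref (fun p => Φ p + ε) (fun p => Φ p + α * (d - c)) :=
    h.mono _ _ q2 q1 fun p _ => by linarith
  exact ⟨h.trans _ _ _ q2 q1 hΦ hle key.1, fun hn => key.2 (h.trans _ _ _ hΦ q2 q1 hn hle)⟩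

/-- Weak preferences are preserved by mixing. -/
lemma pref_mix (h : IsDualPref pref)
    (hs : ∀ Φ ∈ Qb, ∀ ε : ℝ, 0 < ε → StrictPref pref (fun p => Φ p + ε) Φ)
    {Φ Ψ Υ : ℝ → ℝ} (hΦ : Φ ∈ Qb) (hΨ : Ψ ∈ Qb) (hΥ : Υ ∈ Qb) (hp : pref Φ Ψ)
    {α : ℝ} (hα0 : 0 < α) (hα1 : α < 1) :
    pref (fun p => α * Φ p + (1 - α) * Υ p) (fun p => α * Ψ p + (1 - α) * Υ p) := by
  have qΦ := combination_mem_Qb hΦ hΥ hα0.le (sub_pos.2 hα1).le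
  have qΨ := combination_mem_Qb hΨ hΥ hα0.le (sub_pos.2 hα1).le
  refine (h.cont _ qΨ _ _ (fun n => add_const_mem_Qb qΦ _) qΦ
    (unifTendsto_add_div _ α)).2 fun n => ?_
  have q := add_const_mem_Qb hΦ (1 / ((n : ℝ) + 1))
  have hn := hs Φ hΦ (1 / ((n : ℝ) + 1)) (by positivity)
  have := (h.indep _ _ _ q hΨ hΥ ⟨h.trans _ _ _ q hΦ hΨ hn.1 hp, fun hc =>
    hn.2 (h.trans _ _ _ hΦ hΨ q hp hc)⟩ α ⟨hα0, hα1⟩).1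
  convert this using 2
  ring

/-- Every prospect has a certainty equivalent. -/
lemma exists_certainty_equivalent (h : IsDualPref pref)
    (hs : ∀ Φ ∈ Qb, ∀ ε : ℝ, 0 < ε → StrictPref pref (fun p => Φ p + ε) Φ)
    {Φ : ℝ → ℝ} (hΦ : Φ ∈ Qb) :
    ∃ u : ℝ, pref Φ (fun _ => u) ∧ pref (fun _ => u) Φ := by
  set S : Set ℝ := {c | pref Φ (fun _ => c)} with hS
  obtain ⟨C, hC⟩ := hΦ.1
  have hne : S.Nonempty := ⟨-C, h.mono _ _ hΦ (const_mem_Qb _) fun p hp => (abs_le.1 (hC p hp)).1⟩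
  have hbdd : BddAbove S := by
    refine ⟨C, fun c hc => ?_⟩
    by_contra! hlt
    have hst := hs _ (const_mem_Qb C) (c - C) (sub_pos.2 hlt)
    simp only [add_sub_cancel] at hst
    exact hst.2 (h.trans _ _ _ (const_mem_Qb C) hΦ (const_mem_Qb c)
      (h.mono _ _ (const_mem_Qb C) hΦ fun p hp => (abs_le.1 (hC p hp)).2) hc)
  refine ⟨sSup S, ?_, ?_⟩
  · refine (h.cont Φ hΦ _ _ (fun n => add_const_mem_Qb (const_mem_Qb _) _) (const_mem_Qb _)
      (unifTendsto_add_div _ (-1))).1 fun n => ?_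
    have hpos : 0 < 1 / ((n : ℝ) + 1) := by positivity
    obtain ⟨c, hc, hlt⟩ := exists_lt_of_lt_csSup hne
      (show sSup S + -1 * (1 / ((n : ℝ) + 1)) < sSup S by linarith)
    exact h.trans _ _ _ hΦ (const_mem_Qb c) (const_mem_Qb _) hc
      (h.mono _ _ (const_mem_Qb c) (const_mem_Qb _) fun _ _ => hlt.le)
  · refine (h.cont Φ hΦ _ _ (fun n => add_const_mem_Qb (const_mem_Qb _) _) (const_mem_Qb _)
      (unifTendsto_add_div _ 1)).2 fun n => ?_
    have hpos : 0 < 1 / ((n : ℝ) + 1) := by positivity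
    refine (h.total _ _ (const_mem_Qb _) hΦ).resolve_right fun hc => ?_
    have : sSup S + 1 * (1 / ((n : ℝ) + 1)) ≤ sSup S := le_csSup hbdd hc
    linarith

/-- A nontrivial preference is represented on `Qb` by an additive and positively homogeneous
functional which is the identity on constants. -/
lemma exists_positively_linear_representation (h : IsDualPref pref)
    (hs : ∀ Φ ∈ Qb, ∀ ε : ℝ, 0 < ε → StrictPref pref (fun p => Φ p + ε) Φ) :
    ∃ V : (ℝ → ℝ) → ℝ, (∀ Φ ∈ Qb, ∀ Ψ ∈ Qb, (pref Φ Ψ ↔ V Ψ ≤ V Φ)) ∧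
      (∀ c, V (fun _ => c) = c) ∧
      (∀ Φ ∈ Qb, ∀ Ψ ∈ Qb, V (fun p => Φ p + Ψ p) = V Φ + V Ψ) ∧
      (∀ Φ ∈ Qb, ∀ a : ℝ, 0 < a → V (fun p => a * Φ p) = a * V Φ) := by
  choose! V hV using fun (Φ : ℝ → ℝ) (hΦ : Φ ∈ Qb) => h.exists_certainty_equivalent hs hΦ
  have hconst (c d : ℝ) : pref (fun _ => c) (fun _ => d) ↔ d ≤ c := by
    refine ⟨fun hcd => ?_, fun hle => h.mono _ _ (const_mem_Qb c) (const_mem_Qb d) fun _ _ => hle⟩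
    by_contra! hlt
    have := (hs _ (const_mem_Qb c) (d - c) (sub_pos.2 hlt)).2
    simp only [add_sub_cancel] at this
    exact this hcd
  have hrep : ∀ Φ ∈ Qb, ∀ Ψ ∈ Qb, (pref Φ Ψ ↔ V Ψ ≤ V Φ) := by
    intro Φ hΦ Ψ hΨ
    rw [← hconst]
    have q1 := const_mem_Qb (V Φ)
    have q2 := const_mem_Qb (V Ψ)
    exact ⟨fun hp => h.trans _ _ _ q1 hΦ q2 (hV Φ hΦ).2 (h.trans _ _ _ hΦ hΨ q2 hp (hV Ψ hΨ).1),
      fun hp => h.trans _ _ _ hΦ q1 hΨ (hV Φ hΦ).1 (h.trans _ _ _ q1 q2 hΨ hp (hV Ψ hΨ).2)⟩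
  have hVc (c : ℝ) : V (fun _ => c) = c :=
    le_antisymm ((hconst _ _).1 (hV _ (const_mem_Qb c)).1) ((hconst _ _).1 (hV _ (const_mem_Qb c)).2)
  have hmixle : ∀ Φ ∈ Qb, ∀ Φ' ∈ Qb, ∀ Ψ ∈ Qb, V Φ = V Φ' → ∀ α : ℝ, 0 < α → α < 1 →
      V (fun p => α * Φ p + (1 - α) * Ψ p) = V (fun p => α * Φ' p + (1 - α) * Ψ p) := by
    intro Φ hΦ Φ' hΦ' Ψ hΨ he α h0 h1
    have q1 := combination_mem_Qb hΦ hΨ h0.le (sub_pos.2 h1).le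
    have q2 := combination_mem_Qb hΦ' hΨ h0.le (sub_pos.2 h1).le
    exact le_antisymm
      ((hrep _ q2 _ q1).1 (h.pref_mix hs hΦ' hΦ hΨ ((hrep _ hΦ' _ hΦ).2 he.le) h0 h1))
      ((hrep _ q1 _ q2).1 (h.pref_mix hs hΦ hΦ' hΨ ((hrep _ hΦ _ hΦ').2 he.ge) h0 h1))
  have hmix : ∀ Φ ∈ Qb, ∀ Ψ ∈ Qb, ∀ α : ℝ, 0 < α → α < 1 →
      V (fun p => α * Φ p + (1 - α) * Ψ p) = α * V Φ + (1 - α) * V Ψ := by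
    intro Φ hΦ Ψ hΨ α h0 h1
    rw [hmixle Φ hΦ _ (const_mem_Qb (V Φ)) Ψ hΨ (hVc _).symm α h0 h1]
    have := hmixle Ψ hΨ _ (const_mem_Qb (V Ψ)) _ (const_mem_Qb (V Φ)) (hVc _).symm (1 - α)
      (sub_pos.2 h1) (by linarith)
    simp only [sub_sub_cancel, hVc] at this
    rw [add_comm (α * V Φ), ← this]
    simp only [add_comm]
  have hsmall : ∀ Φ ∈ Qb, ∀ α : ℝ, 0 < α → α < 1 → V (fun p => α * Φ p) = α * V Φ := by
    intro Φ hΦ α h0 h1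
    simpa [hVc] using hmix Φ hΦ _ (const_mem_Qb 0) α h0 h1
  refine ⟨V, hrep, hVc, fun Φ hΦ Ψ hΨ => ?_, fun Φ hΦ a ha => ?_⟩
  · have e1 := hmix Φ hΦ Ψ hΨ (1 / 2) (by norm_num) (by norm_num)
    have e2 := hsmall _ (add_mem_Qb hΦ hΨ) (1 / 2) (by norm_num) (by norm_num)
    have : (fun p => 1 / 2 * Φ p + (1 - 1 / 2) * Ψ p) = fun p => 1 / 2 * (Φ p + Ψ p) := by
      funext p; ring
    rw [this, e2] at e1
    linarith
  · rcases lt_trichotomy a 1 with h1 | rfl | h1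
    · exact hsmall Φ hΦ a ha h1
    · simp
    · have := hsmall _ (const_mul_mem_Qb hΦ ha.le) a⁻¹ (inv_pos.2 ha) (inv_lt_one_of_one_lt₀ h1)
      simp only [inv_mul_cancel_left₀ ha.ne'] at this
      rw [this, mul_inv_cancel_left₀ ha.ne']

end IsDualPref

/-- The functions bounded on `(0,1]`. -/
def boundedFns : Submodule ℝ (ℝ → ℝ) where
  carrier := {f | ∃ C : ℝ, ∀ p ∈ Set.Ioc (0:ℝ) 1, |f p| ≤ C}
  zero_mem' := ⟨0, by simp⟩
  add_mem' := by
    rintro f g ⟨C, hC⟩ ⟨D, hD⟩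
    exact ⟨C + D, fun p hp => (abs_add_le _ _).trans (add_le_add (hC p hp) (hD p hp))⟩
  smul_mem' := by
    rintro a f ⟨C, hC⟩
    refine ⟨|a| * C, fun p hp => ?_⟩
    simpa [abs_mul] using mul_le_mul_of_nonneg_left (hC p hp) (abs_nonneg a)

lemma BSpace_subset_boundedFns {f : ℝ → ℝ} (hf : f ∈ BSpace) : f ∈ boundedFns := by
  obtain ⟨g, hg, hlim⟩ := hf
  obtain ⟨N, hN⟩ := hlim 1 one_pos
  obtain ⟨n, c, A, -, -, hgc⟩ := hg N
  refine ⟨∑ i, |c i| + 1, fun p hp => ?_⟩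
  have h1 := hN N le_rfl p hp
  have h2 : |g N p| ≤ ∑ i, |c i| := by
    rw [hgc p hp]
    refine (Finset.abs_sum_le_sum_abs _ _).trans (Finset.sum_le_sum fun i _ => ?_)
    by_cases hi : p ∈ A i <;> simp [hi]
  calc |f p| = |g N p - (g N p - f p)| := by ring_nf
    _ ≤ |g N p| + |g N p - f p| := abs_sub _ _
    _ ≤ _ := add_le_add h2 h1

lemma abs_le_supAbs {f : ℝ → ℝ} (hf : f ∈ boundedFns) {p : ℝ} (hp : p ∈ Set.Ioc (0:ℝ) 1) :
    |f p| ≤ supAbs f := by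
  obtain ⟨C, hC⟩ := hf
  exact le_ciSup (f := fun p : Set.Ioc (0:ℝ) 1 => |f p.1|)
    ⟨C, by rintro _ ⟨q, rfl⟩; exact hC q q.2⟩ ⟨p, hp⟩

/-- A monotone, additive and positively homogeneous functional on `Qb` which is the identity on
constants extends to a linear functional bounded by the supremum norm. -/
lemma exists_linear_extension (V : (ℝ → ℝ) → ℝ)
    (hmono : ∀ Φ ∈ Qb, ∀ Ψ ∈ Qb, (∀ p ∈ Set.Ioc (0:ℝ) 1, Ψ p ≤ Φ p) → V Ψ ≤ V Φ)
    (hconst : ∀ c, V (fun _ => c) = c)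
    (hadd : ∀ Φ ∈ Qb, ∀ Ψ ∈ Qb, V (fun p => Φ p + Ψ p) = V Φ + V Ψ)
    (hmul : ∀ Φ ∈ Qb, ∀ a : ℝ, 0 < a → V (fun p => a * Φ p) = a * V Φ) :
    ∃ U : (ℝ → ℝ) →ₗ[ℝ] ℝ, (∀ f ∈ boundedFns, |U f| ≤ supAbs f) ∧ ∀ Φ ∈ Qb, U Φ = V Φ := by
  let S : boundedFns → Set ℝ := fun f => {x | ∃ Φ ∈ Qb, ∃ Ψ ∈ Qb,
    (∀ p ∈ Set.Ioc (0:ℝ) 1, f.1 p + Ψ p ≤ Φ p) ∧ x = V Φ - V Ψ}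
  have hV0 : V (fun _ => 0) = 0 := hconst 0
  have hSc (f : boundedFns) (c : ℝ) (hc : ∀ p ∈ Set.Ioc (0:ℝ) 1, f.1 p ≤ c) : c ∈ S f :=
    ⟨_, const_mem_Qb c, _, const_mem_Qb 0, fun p hp => by simpa using hc p hp, by simp [hconst]⟩
  have hne (f : boundedFns) : (S f).Nonempty := by
    obtain ⟨C, hC⟩ := f.2
    exact ⟨C, hSc f C fun p hp => (abs_le.1 (hC p hp)).2⟩
  have hbdd (f : boundedFns) : BddBelow (S f) := by
    obtain ⟨C, hC⟩ := f.2
    refine ⟨-C, ?_⟩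
    rintro _ ⟨Φ, hΦ, Ψ, hΨ, hle, rfl⟩
    have := hmono Φ hΦ _ (add_const_mem_Qb hΨ (-C)) fun p hp => by
      linarith [hle p hp, (abs_le.1 (hC p hp)).1]
    rw [hadd Ψ hΨ _ (const_mem_Qb _), hconst] at this
    linarith
  have hscale (c : ℝ) (hc : 0 < c) (f : boundedFns) : sInf (S (c • f)) ≤ c * sInf (S f) := by
    rw [← div_le_iff₀' hc]
    refine le_csInf (hne f) ?_
    rintro _ ⟨Φ, hΦ, Ψ, hΨ, hle, rfl⟩
    rw [div_le_iff₀' hc]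
    refine csInf_le (hbdd _) ⟨_, const_mul_mem_Qb hΦ hc.le, _, const_mul_mem_Qb hΨ hc.le,
      fun p hp => ?_, ?_⟩
    · have := mul_le_mul_of_nonneg_left (hle p hp) hc.le
      rw [mul_add] at this
      exact this
    · rw [hmul Φ hΦ c hc, hmul Ψ hΨ c hc, mul_sub]
  obtain ⟨g, -, hg⟩ := exists_extension_of_le_sublinear (⟨⊥, 0⟩ : boundedFns →ₗ.[ℝ] ℝ)
    (fun f => sInf (S f)) (fun c hc f => by
      refine le_antisymm (hscale c hc f) ?_
      have := hscale c⁻¹ (inv_pos.2 hc) (c • f)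
      rw [inv_smul_smul₀ hc.ne', ← div_eq_inv_mul, le_div_iff₀' hc] at this
      exact this)
    (fun f g => by
      rw [← sub_le_iff_le_add]
      refine le_csInf (hne f) ?_
      rintro x ⟨Φ, hΦ, Ψ, hΨ, hle, rfl⟩
      rw [sub_le_comm]
      refine le_csInf (hne g) ?_
      rintro y ⟨Φ', hΦ', Ψ', hΨ', hle', rfl⟩
      rw [sub_le_iff_le_add]
      refine csInf_le (hbdd _) ⟨_, add_mem_Qb hΦ hΦ', _, add_mem_Qb hΨ hΨ', fun p hp => ?_, ?_⟩
      · have h1 := hle p hp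
        have h2 := hle' p hp
        have : (f + g).1 p = f.1 p + g.1 p := rfl
        linarith
      · rw [hadd Φ hΦ Φ' hΦ', hadd Ψ hΨ Ψ' hΨ']
        ring)
    (by
      rintro ⟨x, hx⟩
      obtain rfl : x = 0 := by simpa using hx
      change (0 : ℝ) ≤ sInf (S 0)
      refine le_csInf (hne 0) ?_
      rintro _ ⟨Φ, hΦ, Ψ, hΨ, hle, rfl⟩
      exact sub_nonneg.2 (hmono Φ hΦ Ψ hΨ fun p hp => by simpa using hle p hp))
  obtain ⟨U, hU⟩ := LinearMap.exists_extend g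
  have hUg (f : ℝ → ℝ) (hf : f ∈ boundedFns) : U f = g ⟨f, hf⟩ := LinearMap.congr_fun hU ⟨f, hf⟩
  have hle (f : boundedFns) {x : ℝ} (hx : x ∈ S f) : g f ≤ x := (hg f).trans (csInf_le (hbdd f) hx)
  refine ⟨U, fun f hf => ?_, fun Φ hΦ => ?_⟩
  · rw [hUg f hf, abs_le']
    refine ⟨hle _ (hSc _ _ fun p hp => (abs_le.1 (abs_le_supAbs hf hp)).2), ?_⟩
    rw [← map_neg]
    exact hle _ (hSc _ _ fun p hp => neg_le.1 (abs_le.1 (abs_le_supAbs hf hp)).1)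
  · rw [hUg Φ hΦ.1]
    refine le_antisymm
      (hle _ ⟨Φ, hΦ, _, const_mem_Qb 0, fun p _ => by simp, by rw [hV0, sub_zero]⟩) ?_
    rw [← neg_le_neg_iff, ← map_neg]
    exact hle _ ⟨_, const_mem_Qb 0, Φ, hΦ, fun p _ => by simp, by rw [hV0, zero_sub]⟩

/-- A continuous (sup-norm), monotonic total preorder on `Q_b` satisfying the dual
independence axiom extends to a continuous linear functional on `B((0,1],Σ)` whose
restriction to `Q_b` is a numerical representation. -/
theorem exists_continuous_linear_dual_representation
    (pref : (ℝ → ℝ) → (ℝ → ℝ) → Prop)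
    (hrefl : ∀ Φ ∈ Qb, pref Φ Φ)
    (htrans : ∀ Φ Ψ Υ, Φ ∈ Qb → Ψ ∈ Qb → Υ ∈ Qb → pref Φ Ψ → pref Ψ Υ → pref Φ Υ)
    (htotal : ∀ Φ Ψ, Φ ∈ Qb → Ψ ∈ Qb → pref Φ Ψ ∨ pref Ψ Φ)
    (hmono : ∀ Φ Ψ, Φ ∈ Qb → Ψ ∈ Qb → (∀ p ∈ Set.Ioc (0:ℝ) 1, Ψ p ≤ Φ p) → pref Φ Ψ)
    (hcont : ∀ Φ ∈ Qb, ∀ (Ψs : ℕ → ℝ → ℝ) (Ψ : ℝ → ℝ), (∀ n, Ψs n ∈ Qb) → Ψ ∈ Qb →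
      UnifTendsto Ψs Ψ →
      ((∀ n, pref Φ (Ψs n)) → pref Φ Ψ) ∧ ((∀ n, pref (Ψs n) Φ) → pref Ψ Φ))
    (hind : ∀ Φ Ψ Υ, Φ ∈ Qb → Ψ ∈ Qb → Υ ∈ Qb → StrictPref pref Φ Ψ →
      ∀ α ∈ Set.Ioo (0:ℝ) 1,
        StrictPref pref (fun p => α * Φ p + (1 - α) * Υ p)
          (fun p => α * Ψ p + (1 - α) * Υ p)) :
    ∃ U : (ℝ → ℝ) → ℝ,
      (∀ f g, f ∈ BSpace → g ∈ BSpace → ∀ a b : ℝ,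
        U (fun p => a * f p + b * g p) = a * U f + b * U g) ∧
      (∃ C : ℝ, ∀ f ∈ BSpace, |U f| ≤ C * supAbs f) ∧
      (∀ Φ Ψ, Φ ∈ Qb → Ψ ∈ Qb → (StrictPref pref Φ Ψ ↔ U Φ > U Ψ)) := by
  have h : IsDualPref pref := ⟨htrans, htotal, hmono, hcont, hind⟩
  by_cases htriv : ∃ Φ₀ ∈ Qb, ∃ Ψ₀ ∈ Qb, StrictPref pref Φ₀ Ψ₀
  · obtain ⟨Φ₀, hΦ₀, Ψ₀, hΨ₀, h₀⟩ := htriv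
    obtain ⟨V, hrep, hVc, hVadd, hVmul⟩ := h.exists_positively_linear_representation
      fun Φ hΦ ε hε => h.strictPref_add_const hΦ₀ hΨ₀ h₀ hΦ hε
    obtain ⟨U, hUb, hUV⟩ := exists_linear_extension V
      (fun Φ hΦ Ψ hΨ hle => (hrep Φ hΦ Ψ hΨ).1 (hmono Φ Ψ hΦ hΨ hle)) hVc hVadd hVmul
    refine ⟨U, fun f g _ _ a b => ?_, ⟨1, fun f hf => ?_⟩, fun Φ Ψ hΦ hΨ => ?_⟩
    · exact (U.map_add (a • f) (b • g)).trans (by simp)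
    · simpa using hUb f (BSpace_subset_boundedFns hf)
    · rw [StrictPref, hrep Φ hΦ Ψ hΨ, hrep Ψ hΨ Φ hΦ, hUV Φ hΦ, hUV Ψ hΨ]
      exact lt_iff_le_not_ge.symm
  · push Not at htriv
    exact ⟨fun _ => 0, by simp, ⟨0, by simp⟩, fun Φ Ψ hΦ hΨ => by simpa using htriv Φ hΦ Ψ hΨ⟩
end

section
/- Let Q_b be the set of bounded, nondecreasing, left-continuous functions on (0,1], and let ⪯ be a total preorder on Q_b represented by the Choquet functional U(F^{-1}) = −∫_{−∞}^0 w(F(z)) dz + ∫_0^∞ [1 − w(F(z))] dz for a nondecreasing function w : [0,1] → [0,1] with w(0)=0 and w(1)=1, where F is the distribution function associated with a quantile function Φ = F^{-1}. For Φ ∈ Q_b, let Φ_{G₀} denote the constant quantile function equal to the mean ∫₀¹ Φ(p) dp (the quantile function of the expected value). Then Φ_{G₀} ⪰ Φ holds for all Φ ∈ Q_b if and only if w(p) ≥ p for all p ∈ (0,1]. -/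
open MeasureTheory

/-- The distribution function associated with a quantile function `Φ`:
`F(z) = sup {p ∈ [0,1] : Φ(p) ≤ z}` (and `F(z) = 0` below the support). -/
noncomputable def distFn (Φ : ℝ → ℝ) (z : ℝ) : ℝ :=
  sSup ({0} ∪ {p | p ∈ Set.Ioc (0:ℝ) 1 ∧ Φ p ≤ z})

/-- The Choquet-type functional
`U(F⁻¹) = −∫_{−∞}^0 w(F(z)) dz + ∫_0^∞ [1 − w(F(z))] dz`. -/
noncomputable def choquet (w : ℝ → ℝ) (Φ : ℝ → ℝ) : ℝ :=
  -(∫ z in Set.Iic (0:ℝ), w (distFn Φ z)) + ∫ z in Set.Ici (0:ℝ), (1 - w (distFn Φ z))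

theorem bddAbove_distFn_set (Φ : ℝ → ℝ) (z : ℝ) :
    BddAbove ({0} ∪ {p | p ∈ Set.Ioc (0:ℝ) 1 ∧ Φ p ≤ z}) := by
  refine ⟨1, ?_⟩
  rintro p (rfl | hp)
  · exact zero_le_one
  · exact hp.1.2

theorem le_distFn {Φ : ℝ → ℝ} {z p : ℝ} (hp : p ∈ Set.Ioc (0:ℝ) 1) (h : Φ p ≤ z) :
    p ≤ distFn Φ z :=
  le_csSup (bddAbove_distFn_set Φ z) (Or.inr ⟨hp, h⟩)

theorem distFn_mem_Icc (Φ : ℝ → ℝ) (z : ℝ) : distFn Φ z ∈ Set.Icc (0:ℝ) 1 := by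
  refine ⟨le_csSup (bddAbove_distFn_set Φ z) (Or.inl rfl), csSup_le ⟨0, Or.inl rfl⟩ ?_⟩
  rintro p (rfl | hp)
  · exact zero_le_one
  · exact hp.1.2

theorem monotone_distFn (Φ : ℝ → ℝ) : Monotone (distFn Φ) := by
  intro a b hab
  refine csSup_le_csSup (bddAbove_distFn_set Φ b) ⟨0, Or.inl rfl⟩ ?_
  exact Set.union_subset_union_right _ fun p hp => ⟨hp.1, hp.2.trans hab⟩

theorem distFn_eq_zero {Φ : ℝ → ℝ} {z : ℝ} (h : ∀ p ∈ Set.Ioc (0:ℝ) 1, z < Φ p) :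
    distFn Φ z = 0 := by
  refine le_antisymm (csSup_le ⟨0, Or.inl rfl⟩ ?_) (distFn_mem_Icc Φ z).1
  rintro p (rfl | hp)
  · exact le_rfl
  · exact absurd hp.2 (not_le.2 (h p hp.1))

theorem distFn_eq_one {Φ : ℝ → ℝ} {z : ℝ} (h : Φ 1 ≤ z) : distFn Φ z = 1 :=
  le_antisymm (distFn_mem_Icc Φ z).2 (le_distFn ⟨one_pos, le_rfl⟩ h)

theorem monotone_comp_distFn {w : ℝ → ℝ} (hw : MonotoneOn w (Set.Icc 0 1)) (Φ : ℝ → ℝ) :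
    Monotone fun z => w (distFn Φ z) := fun _ _ hab =>
  hw (distFn_mem_Icc Φ _) (distFn_mem_Icc Φ _) (monotone_distFn Φ hab)

/-- The Choquet functional as an integral over a compact interval containing the support. -/
theorem choquet_eq_sub_intervalIntegral {w : ℝ → ℝ} (hw : MonotoneOn w (Set.Icc 0 1))
    (hw0 : w 0 = 0) (hw1 : w 1 = 1) {Φ : ℝ → ℝ} {C : ℝ}
    (hC : ∀ p ∈ Set.Ioc (0:ℝ) 1, |Φ p| < C) :
    choquet w Φ = C - ∫ z in (-C)..C, w (distFn Φ z) := by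
  have hC1 := hC 1 ⟨one_pos, le_rfl⟩
  have hC0 : 0 < C := (abs_nonneg _).trans_lt hC1
  have hint (a b : ℝ) : IntervalIntegrable (fun z => w (distFn Φ z)) volume a b :=
    (monotone_comp_distFn hw Φ).intervalIntegrable
  have hneg : ∫ z in Set.Iic (0:ℝ), w (distFn Φ z) = ∫ z in (-C)..0, w (distFn Φ z) := by
    rw [intervalIntegral.integral_of_le (by linarith)]
    refine setIntegral_eq_of_subset_of_forall_sdiff_eq_zero measurableSet_Iic
      (fun z hz => hz.2) ?_
    rintro z ⟨hz, hz'⟩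
    have hzC : z ≤ -C := by
      by_contra! h
      exact hz' ⟨h, hz⟩
    rw [distFn_eq_zero fun p hp => hzC.trans_lt (abs_lt.1 (hC p hp)).1, hw0]
  have hpos : ∫ z in Set.Ici (0:ℝ), (1 - w (distFn Φ z)) =
      ∫ z in (0:ℝ)..C, (1 - w (distFn Φ z)) := by
    rw [intervalIntegral.integral_of_le hC0.le, integral_Ici_eq_integral_Ioi]
    refine setIntegral_eq_of_subset_of_forall_sdiff_eq_zero measurableSet_Ioi
      (fun z hz => hz.1) ?_
    rintro z ⟨hz, hz'⟩
    have hzC : C < z := by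
      by_contra! h
      exact hz' ⟨hz, h⟩
    rw [distFn_eq_one ((abs_lt.1 hC1).2.le.trans hzC.le), hw1, sub_self]
  rw [choquet, hneg, hpos, intervalIntegral.integral_sub (by simp) (hint _ _),
    ← intervalIntegral.integral_add_adjacent_intervals (hint (-C) 0) (hint 0 C)]
  simp
  ring

theorem measureReal_sublevel_eq_distFn {Φ : ℝ → ℝ} (hΦ : MonotoneOn Φ (Set.Ioc 0 1)) (z : ℝ) :
    volume.real {p | p ∈ Set.Ioc (0:ℝ) 1 ∧ Φ p ≤ z} = distFn Φ z := by
  have h0 := (distFn_mem_Icc Φ z).1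
  have h1 := (distFn_mem_Icc Φ z).2
  have hsub : {p | p ∈ Set.Ioc (0:ℝ) 1 ∧ Φ p ≤ z} ⊆ Set.Ioc 0 (distFn Φ z) :=
    fun p hp => ⟨hp.1.1, le_distFn hp.1 hp.2⟩
  have hsup : Set.Ioo 0 (distFn Φ z) ⊆ {p | p ∈ Set.Ioc (0:ℝ) 1 ∧ Φ p ≤ z} := by
    rintro p ⟨hp0, hp⟩
    have hp' : p ∈ Set.Ioc (0:ℝ) 1 := ⟨hp0, hp.le.trans h1⟩
    have hne : ({0} ∪ {p | p ∈ Set.Ioc (0:ℝ) 1 ∧ Φ p ≤ z}).Nonempty := ⟨0, Or.inl rfl⟩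
    obtain ⟨q, rfl | hq, hpq⟩ := exists_lt_of_lt_csSup hne hp
    · exact absurd hpq hp0.not_gt
    · exact ⟨hp', (hΦ hp' hq.1 hpq.le).trans hq.2⟩
  apply le_antisymm
  · calc _ ≤ volume.real (Set.Ioc 0 (distFn Φ z)) := measureReal_mono hsub (by simp)
      _ = _ := by simp [h0]
  · calc _ = volume.real (Set.Ioo 0 (distFn Φ z)) := by simp [h0]
      _ ≤ _ := measureReal_mono hsup (measure_ne_top_of_subset hsub (by simp))

/-- The mean of a bounded quantile function in terms of its distribution function. -/
theorem integral_eq_sub_integral_distFn {Φ : ℝ → ℝ} (hΦ : MonotoneOn Φ (Set.Ioc 0 1)) {C : ℝ}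
    (hC : ∀ p ∈ Set.Ioc (0:ℝ) 1, |Φ p| < C) :
    ∫ p in Set.Ioc (0:ℝ) 1, Φ p = C - ∫ z in (-C)..C, distFn Φ z := by
  have hC0 : 0 < C := (abs_nonneg _).trans_lt (hC 1 ⟨one_pos, le_rfl⟩)
  have hint : IntegrableOn Φ (Set.Ioc 0 1) := by
    refine Integrable.of_bound
      (aemeasurable_restrict_of_monotoneOn measurableSet_Ioc hΦ).aestronglyMeasurable C ?_
    filter_upwards [ae_restrict_mem measurableSet_Ioc] with p hp using (hC p hp).le
  have hlayer : ∫ p in Set.Ioc (0:ℝ) 1, (C - Φ p) = ∫ t in Set.Ioi (0:ℝ), distFn Φ (C - t) := by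
    have hC_int : IntegrableOn (fun _ => C) (Set.Ioc (0:ℝ) 1) := by simp
    have hdiff : IntegrableOn (fun p => C - Φ p) (Set.Ioc 0 1) := hC_int.sub hint
    rw [hdiff.integral_eq_integral_meas_le]
    · refine integral_congr_ae (Filter.Eventually.of_forall fun t => ?_)
      beta_reduce
      rw [measureReal_restrict_apply' measurableSet_Ioc, ← measureReal_sublevel_eq_distFn hΦ]
      congr 1
      ext p
      simp only [Set.mem_inter_iff, Set.mem_ofPred_eq, le_sub_comm, and_comm]
    · filter_upwards [ae_restrict_mem measurableSet_Ioc] with p hp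
      exact sub_nonneg.2 (abs_lt.1 (hC p hp)).2.le
  have hcompact : ∫ t in Set.Ioi (0:ℝ), distFn Φ (C - t) =
      ∫ t in (0:ℝ)..2 * C, distFn Φ (C - t) := by
    rw [intervalIntegral.integral_of_le (by linarith)]
    refine setIntegral_eq_of_subset_of_forall_sdiff_eq_zero measurableSet_Ioi
      (fun z hz => hz.1) ?_
    rintro t ⟨ht, ht'⟩
    have htC : 2 * C < t := by
      by_contra! h
      exact ht' ⟨ht, h⟩
    exact distFn_eq_zero fun p hp => lt_trans (by linarith) (abs_lt.1 (hC p hp)).1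
  rw [hcompact, intervalIntegral.integral_comp_sub_left, integral_sub (by simp) hint] at hlayer
  have hends : C - 2 * C = -C := by ring
  simp only [hends, sub_zero, integral_const, measureReal_restrict_apply_univ, Real.volume_real_Ioc,
    smul_eq_mul] at hlayer
  norm_num at hlayer
  linarith

theorem choquet_const {w : ℝ → ℝ} (hw : MonotoneOn w (Set.Icc 0 1))
    (hw0 : w 0 = 0) (hw1 : w 1 = 1) (c : ℝ) : choquet w (fun _ => c) = c := by
  have hC : ∀ p ∈ Set.Ioc (0:ℝ) 1, |(fun _ : ℝ => c) p| < |c| + 1 := fun _ _ => lt_add_one _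
  have hfix (z : ℝ) : w (distFn (fun _ => c) z) = distFn (fun _ => c) z := by
    rcases le_or_gt c z with h | h
    · rw [distFn_eq_one h, hw1]
    · rw [distFn_eq_zero fun _ _ => h, hw0]
  rw [choquet_eq_sub_intervalIntegral hw hw0 hw1 hC]
  simp only [hfix]
  rw [← integral_eq_sub_integral_distFn (fun _ _ _ _ _ => le_rfl) hC]
  simp

theorem choquet_le_choquet_mean_iff {w : ℝ → ℝ} (hw : MonotoneOn w (Set.Icc 0 1))
    (hw0 : w 0 = 0) (hw1 : w 1 = 1) {Φ : ℝ → ℝ} (hΦ : MonotoneOn Φ (Set.Ioc 0 1)) {C : ℝ}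
    (hC : ∀ p ∈ Set.Ioc (0:ℝ) 1, |Φ p| < C) :
    choquet w Φ ≤ choquet w (fun _ => ∫ p in Set.Ioc (0:ℝ) 1, Φ p) ↔
      0 ≤ ∫ z in (-C)..C, (w (distFn Φ z) - distFn Φ z) := by
  rw [choquet_const hw hw0 hw1, integral_eq_sub_integral_distFn hΦ hC,
    choquet_eq_sub_intervalIntegral hw hw0 hw1 hC,
    intervalIntegral.integral_sub (monotone_comp_distFn hw Φ).intervalIntegrable
      (monotone_distFn Φ).intervalIntegrable, sub_nonneg, sub_le_sub_iff_left]

/-- The quantile function of the distribution with mass `p` at `0` and `1 - p` at `1`. -/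
noncomputable def twoPointQuantile (p q : ℝ) : ℝ := if q ≤ p then 0 else 1

theorem abs_twoPointQuantile_le (p q : ℝ) : |twoPointQuantile p q| ≤ 1 := by
  unfold twoPointQuantile
  split_ifs <;> simp

theorem monotone_twoPointQuantile (p : ℝ) : Monotone (twoPointQuantile p) := by
  intro a b hab
  unfold twoPointQuantile
  split_ifs <;> linarith

theorem twoPointQuantile_mem_Qb (p : ℝ) : twoPointQuantile p ∈ Qb := by
  refine ⟨⟨1, fun q _ => abs_twoPointQuantile_le p q⟩,
    (monotone_twoPointQuantile p).monotoneOn _, fun q _ => ?_⟩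
  rcases le_or_gt q p with h | h
  · refine (continuousWithinAt_const (b := (0:ℝ))).congr (fun x hx => ?_) (if_pos h)
    exact if_pos ((Set.mem_Iio.1 hx).le.trans h)
  · refine ((continuousAt_const (y := (1:ℝ))).congr ?_).continuousWithinAt
    filter_upwards [lt_mem_nhds h] with x hx
    exact (if_neg hx.not_ge).symm

theorem distFn_twoPointQuantile {p : ℝ} (hp : p ∈ Set.Ioc (0:ℝ) 1) {z : ℝ}
    (hz : z ∈ Set.Ico (0:ℝ) 1) : distFn (twoPointQuantile p) z = p := by
  refine le_antisymm (csSup_le ⟨0, Or.inl rfl⟩ ?_) (le_distFn hp ?_)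
  · rintro q (rfl | ⟨-, hq⟩)
    · exact hp.1.le
    · by_contra! h
      rw [twoPointQuantile, if_neg h.not_ge] at hq
      exact hz.2.not_ge hq
  · rw [twoPointQuantile, if_pos le_rfl]
    exact hz.1

theorem integral_comp_distFn_twoPointQuantile {w : ℝ → ℝ} (hw0 : w 0 = 0) (hw1 : w 1 = 1) {p : ℝ}
    (hp : p ∈ Set.Ioc (0:ℝ) 1) :
    ∫ z in (-2:ℝ)..2, (w (distFn (twoPointQuantile p) z) - distFn (twoPointQuantile p) z) =
      w p - p := by
  have hind : (fun z => w (distFn (twoPointQuantile p) z) - distFn (twoPointQuantile p) z) =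
      (Set.Ico (0:ℝ) 1).indicator fun _ => w p - p := by
    ext z
    by_cases hz : z ∈ Set.Ico (0:ℝ) 1
    · rw [Set.indicator_of_mem hz, distFn_twoPointQuantile hp hz]
    rw [Set.indicator_of_notMem hz]
    rcases lt_or_ge z 0 with h | h
    · rw [distFn_eq_zero, hw0, sub_zero]
      intro q _
      unfold twoPointQuantile
      split_ifs <;> linarith
    · have h1 : 1 ≤ z := by
        by_contra! h'
        exact hz ⟨h, h'⟩
      rw [distFn_eq_one ((le_abs_self _).trans ((abs_twoPointQuantile_le p 1).trans h1)), hw1,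
        sub_self]
  have hinter : Set.Ioc (-2:ℝ) 2 ∩ Set.Ico 0 1 = Set.Ico 0 1 :=
    Set.inter_eq_right.2 fun z hz => ⟨by linarith [hz.1], by linarith [hz.2]⟩
  rw [hind, intervalIntegral.integral_of_le (by norm_num), setIntegral_indicator measurableSet_Ico,
    hinter]
  simp

/-- For the preorder on `Q_b` represented by the Choquet functional with distortion
`w : [0,1] → [0,1]`, `w(0)=0`, `w(1)=1`, the constant prospect equal to the mean
`∫₀¹ Φ(p) dp` is weakly preferred to `Φ` for every `Φ ∈ Q_b` if and only if
`w(p) ≥ p` for all `p ∈ (0,1]`. -/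
theorem mean_preferred_iff_w_ge_id
    (w : ℝ → ℝ) (hw : MonotoneOn w (Set.Icc 0 1))
    (hmaps : Set.MapsTo w (Set.Icc 0 1) (Set.Icc 0 1))
    (hw0 : w 0 = 0) (hw1 : w 1 = 1)
    (pref : (ℝ → ℝ) → (ℝ → ℝ) → Prop)
    (hpref : ∀ Φ Ψ : ℝ → ℝ, pref Φ Ψ ↔ choquet w Φ ≥ choquet w Ψ) :
    (∀ Φ ∈ Qb, pref (fun _ => ∫ p in Set.Ioc (0:ℝ) 1, Φ p) Φ) ↔
      ∀ p ∈ Set.Ioc (0:ℝ) 1, p ≤ w p := by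
  simp only [hpref, ge_iff_le]
  constructor
  · intro h p hp
    have hΦ := twoPointQuantile_mem_Qb p
    have := (choquet_le_choquet_mean_iff hw hw0 hw1 hΦ.2.1
      fun q _ => (abs_twoPointQuantile_le p q).trans_lt one_lt_two).1 (h _ hΦ)
    rwa [integral_comp_distFn_twoPointQuantile hw0 hw1 hp, sub_nonneg] at this
  · rintro h Φ ⟨⟨C, hC⟩, hΦ, -⟩
    have hC0 : 0 ≤ C := (abs_nonneg _).trans (hC 1 ⟨one_pos, le_rfl⟩)
    rw [choquet_le_choquet_mean_iff hw hw0 hw1 hΦ fun p hp => (hC p hp).trans_lt (lt_add_one C)]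
    refine intervalIntegral.integral_nonneg (by linarith) fun z _ => sub_nonneg.2 ?_
    rcases (distFn_mem_Icc Φ z).1.eq_or_lt with h0 | h0
    · rw [← h0, hw0]
    · exact h _ ⟨h0, (distFn_mem_Icc Φ z).2⟩
end
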